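/- The function u^T solves the comb-strategy linear PDE: for every 0 ≤ t < T and every x ∈ ℝ⁴ with x₁ ≤ x₂ ≤ x₃ ≤ x₄, one has ∂_t u^T(t,x) + (1/2)(∂²_{x₂x₂} u^T(t,x) + 2 ∂²_{x₂x₄} u^T(t,x) + ∂²_{x₄x₄} u^T(t,x)) = 0 (i.e. ∂_t u^T + (1/2)(e₂+e₄)^⊤ ∂²_{xx} u^T (e₂+e₄) = 0, where e₂, e₄ are standard basis vectors of ℝ⁴). -/

import Mathlib

open MeasureTheory Finset

noncomputable section

/-- The 2π-periodic square wave ψ(r) = sign(sin r). -/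
def psi (r : ℝ) : ℝ := Real.sign (Real.sin r)

/-- The vectors α_k ∈ ℝ⁴, α_{k,j} = 3/√2 if k = j and −1/√2 otherwise. -/
def alph : Fin 4 → Fin 4 → ℝ := fun k j => if k = j then 3 / Real.sqrt 2 else -(1 / Real.sqrt 2)

/-- The vector θ = (1/√2)(1,1,−1,−1) ∈ ℝ⁴. -/
def theta : Fin 4 → ℝ :=
  ![1 / Real.sqrt 2, 1 / Real.sqrt 2, -(1 / Real.sqrt 2), -(1 / Real.sqrt 2)]

/-- Euclidean dot product on ℝ⁴. -/
def dot (a b : Fin 4 → ℝ) : ℝ := ∑ j, a j * b j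

/-- The auxiliary function Λ(r,x). -/
def Lam (r : ℝ) (x : Fin 4 → ℝ) : ℝ :=
  psi (r * dot theta x + Real.pi / 2) * (∑ k, Real.cos (r * dot (alph k) x)) - 4
    - psi (r * dot theta x) * (∑ k, Real.sin (r * dot (alph k) x))

/-- x^o : the increasing rearrangement of the coordinates of x. -/
def sortv (x : Fin 4 → ℝ) : Fin 4 → ℝ := fun i => x (Tuple.sort x i)

/-- The function u^T(t,x). -/
def u (T t : ℝ) (x : Fin 4 → ℝ) : ℝ :=
  -(1 / (16 * Real.sqrt 2)) *
      (∫ r : ℝ, Real.exp (-(T - t) * r ^ 2) * Lam r (sortv x) / r ^ 2)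
    + (1 / 4) * ∑ i, x i + (1 / 2) * Real.sqrt ((T - t) * Real.pi / 2)

/-- Partial derivative in the i-th coordinate. -/
def pd (i : Fin 4) (f : (Fin 4 → ℝ) → ℝ) (x : Fin 4 → ℝ) : ℝ :=
  deriv (fun s => f (Function.update x i s)) (x i)

open Filter Topology

lemma gInt {κ : ℝ} (hκ : 0 < κ) (f : ℝ → ℝ) (hf : Measurable f) (A B : ℝ)
    (h : ∀ r, |f r| ≤ A + B * |r|) : Integrable (fun r => Real.exp (-κ * r ^ 2) * f r) := by
  have h1 := integrable_exp_neg_mul_sq hκ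
  have h2 := (integrable_mul_exp_neg_mul_sq hκ).norm
  refine Integrable.mono' ((h1.const_mul A).add (h2.const_mul B)) (by fun_prop) ?_
  refine Eventually.of_forall fun r => ?_
  have := h r
  simp only [Pi.add_apply, norm_mul, Real.norm_eq_abs, Real.abs_exp]
  nlinarith [Real.exp_pos (-κ * r ^ 2)]

lemma gDeriv {κ : ℝ} (hκ : 0 < κ) (f : ℝ → ℝ → ℝ) (f' : ℝ → ℝ) (s0 A B : ℝ)
    (hm : ∀ s, Measurable (f s)) (hm' : Measurable f')
    (hb : ∀ r, |f s0 r| ≤ A + B * |r|)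
    (hl : ∀ᶠ s in 𝓝 s0, ∀ r, |f s r - f s0 r| ≤ (A + B * |r|) * |s - s0|)
    (hd : ∀ᵐ r, HasDerivAt (fun s => f s r) (f' r) s0) :
    HasDerivAt (fun s => ∫ r, Real.exp (-κ * r ^ 2) * f s r)
      (∫ r, Real.exp (-κ * r ^ 2) * f' r) s0 := by
  have h1 := integrable_exp_neg_mul_sq hκ
  have h2 := (integrable_mul_exp_neg_mul_sq hκ).norm
  have hbi := (h1.const_mul A).add (h2.const_mul B)
  have key := hasFDerivAt_integral_of_dominated_loc_of_lip' (μ := volume) (𝕜 := ℝ)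
    (F := fun s r => Real.exp (-κ * r ^ 2) * f s r)
    (F' := fun r => (ContinuousLinearMap.toSpanSingleton ℝ (Real.exp (-κ * r ^ 2) * f' r)))
    (x₀ := s0) hl (fun s _ => by have := hm s; fun_prop)
    (gInt hκ _ (hm s0) A B hb) ?_ ?_ hbi ?_
  · have h3 := key.1
    have h4 := key.2.hasDerivAt
    rw [ContinuousLinearMap.integral_apply h3] at h4
    simp only [ContinuousLinearMap.toSpanSingleton_apply, one_smul] at h4
    exact h4
  · have : Measurable (fun r => Real.exp (-κ * r ^ 2) * f' r) := by fun_prop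
    exact ((ContinuousLinearMap.toSpanSingletonCLE (𝕜 := ℝ) (E := ℝ)).continuous.measurable.comp this).aestronglyMeasurable
  · refine Eventually.of_forall fun r s hs => ?_
    have := hs r
    simp only [Pi.add_apply, norm_mul, Real.norm_eq_abs, Real.abs_exp, ← mul_sub]
    nlinarith [Real.exp_pos (-κ * r ^ 2)]
  · filter_upwards [hd] with r hr
    exact (hr.const_mul (Real.exp (-κ * r ^ 2))).hasFDerivAt

lemma ctrl (p : ℝ → ℝ) (p1 s0 : ℝ) (h : HasDerivAt p p1 s0) :
    ∃ C, ∀ M, C ≤ M → ∀ᶠ s in 𝓝 s0, |p s| ≤ M ∧ |p s - p s0| ≤ M * |s - s0| := by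
  obtain ⟨C, hC⟩ := h.isBigO_sub.bound
  refine ⟨max C (|p s0| + 1), fun M hM => ?_⟩
  have h2 : ∀ᶠ s in 𝓝 s0, |p s| < |p s0| + 1 :=
    (h.continuousAt.abs).eventually_lt continuousAt_const (by linarith)
  filter_upwards [hC, h2] with s a b
  have h3 := le_max_left C (|p s0| + 1)
  have h4 := le_max_right C (|p s0| + 1)
  simp only [Real.norm_eq_abs] at a
  refine ⟨by linarith, a.trans ?_⟩
  gcongr
  linarith

lemma ctrl3 (p q w : ℝ → ℝ) (p1 q1 w1 s0 : ℝ) (hp : HasDerivAt p p1 s0)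
    (hq : HasDerivAt q q1 s0) (hw : HasDerivAt w w1 s0) :
    ∃ M, 0 ≤ M ∧ (|p s0| ≤ M ∧ |q s0| ≤ M ∧ |w s0| ≤ M) ∧ ∀ᶠ s in 𝓝 s0,
      (|p s| ≤ M ∧ |p s - p s0| ≤ M * |s - s0|) ∧ (|q s| ≤ M ∧ |q s - q s0| ≤ M * |s - s0|) ∧
      (|w s| ≤ M ∧ |w s - w s0| ≤ M * |s - s0|) := by
  obtain ⟨C1, h1⟩ := ctrl p p1 s0 hp
  obtain ⟨C2, h2⟩ := ctrl q q1 s0 hq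
  obtain ⟨C3, h3⟩ := ctrl w w1 s0 hw
  have e1 := h1 (max 0 (max C1 (max C2 C3))) (by simp)
  have e2 := h2 (max 0 (max C1 (max C2 C3))) (by simp)
  have e3 := h3 (max 0 (max C1 (max C2 C3))) (by simp)
  have e := e1.and (e2.and e3)
  have := e.self_of_nhds
  exact ⟨_, le_max_left _ _, ⟨this.1.1, this.2.1.1, this.2.2.1⟩, e⟩

lemma sgn_mul (a : ℝ) : Real.sign a * a = |a| := by
  rcases lt_trichotomy a 0 with h | h | h
  · rw [Real.sign_of_neg h, abs_of_neg h]; ring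
  · simp [h]
  · rw [Real.sign_of_pos h, abs_of_pos h]; ring

lemma sgn_abs (a : ℝ) : |Real.sign a| ≤ 1 := by
  rcases Real.sign_apply_eq a with h | h | h <;> simp [h]

lemma sgn_meas : Measurable Real.sign := by
  unfold Real.sign
  exact Measurable.ite measurableSet_Iio measurable_const
    (Measurable.ite measurableSet_Ioi measurable_const measurable_const)

lemma mulabs (f g : ℝ → ℝ) (f' g' s0 : ℝ) (hf : HasDerivAt f f' s0) (hg : HasDerivAt g g' s0)
    (h : g s0 ≠ 0 ∨ f s0 = 0) :
    HasDerivAt (fun s => f s * |g s|) (f' * |g s0| + f s0 * (Real.sign (g s0) * g')) s0 := by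
  by_cases h0 : g s0 = 0
  · have hf0 : f s0 = 0 := by tauto
    rw [hf0, zero_mul, add_zero]
    rw [hasDerivAt_iff_tendsto_slope] at hf ⊢
    have h2 : Tendsto (fun s => |g s|) (𝓝[≠] s0) (𝓝 |g s0|) :=
      (hg.continuousAt.abs.tendsto).mono_left nhdsWithin_le_nhds
    refine (hf.mul h2).congr fun s => ?_
    simp [slope, hf0, mul_assoc]
  · refine hf.mul ?_
    rcases lt_or_gt_of_ne h0 with h1 | h1
    · rw [Real.sign_of_neg h1]
      have := hasDerivAt_abs_neg h1
      exact this.comp s0 hg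
    · rw [Real.sign_of_pos h1]
      have := hasDerivAt_abs_pos h1
      exact this.comp s0 hg

lemma cosd (a b : ℝ) : |Real.cos a - Real.cos b| ≤ |a + b| * |a - b| / 2 := by
  rw [Real.cos_sub_cos, abs_mul, abs_mul, abs_neg, abs_two]
  have h1 := Real.abs_sin_le_abs (x := (a + b) / 2)
  have h2 := Real.abs_sin_le_abs (x := (a - b) / 2)
  rw [abs_div, abs_two] at h1 h2
  have := mul_le_mul h1 h2 (abs_nonneg _) (by positivity)
  linarith

lemma cosd1 (a b : ℝ) : |Real.cos a - Real.cos b| ≤ |a - b| := by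
  rw [Real.cos_sub_cos, abs_mul, abs_mul, abs_neg, abs_two]
  have h1 := Real.abs_sin_le_one ((a + b) / 2)
  have h2 := Real.abs_sin_le_abs (x := (a - b) / 2)
  rw [abs_div, abs_two] at h2
  have := mul_le_mul h1 h2 (abs_nonneg _) (by positivity)
  linarith

lemma sind1 (a b : ℝ) : |Real.sin a - Real.sin b| ≤ |a - b| := by
  rw [Real.sin_sub_sin, abs_mul, abs_mul, abs_two]
  have h1 := Real.abs_cos_le_one ((a + b) / 2)
  have h2 := Real.abs_sin_le_abs (x := (a - b) / 2)
  rw [abs_div, abs_two] at h2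
  have := mul_le_mul h2 h1 (abs_nonneg _) (by positivity)
  linarith

lemma expd (x y : ℝ) (hx : 0 ≤ x) (hy : 0 ≤ y) : |Real.exp (-x) - Real.exp (-y)| ≤ |x - y| := by
  wlog h : x ≤ y generalizing x y
  · rw [abs_sub_comm, abs_sub_comm x y]; exact this y x hy hx (le_of_not_ge h)
  rw [abs_of_nonneg (by simpa using h), abs_of_nonpos (by linarith)]
  have h1 : Real.exp (-y) = Real.exp (-x) * Real.exp (x - y) := by rw [← Real.exp_add]; ring_nf
  have h2 := Real.add_one_le_exp (x - y)
  have h3 : Real.exp (-x) ≤ 1 := by simpa using hx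
  have h4 := Real.exp_pos (-x)
  rw [h1]
  nlinarith

lemma ae_good (w : ℝ) (hw : w ≠ 0) :
    ∀ᵐ r : ℝ, r ≠ 0 ∧ Real.cos (r * w) ≠ 0 ∧ Real.sin (r * w) ≠ 0 := by
  have hc : (Set.range fun n : ℤ => (n : ℝ) * (Real.pi / 2) / w).Countable := Set.countable_range _
  have := hc.ae_notMem volume
  filter_upwards [this] with r hr
  have key : Real.sin (2 * (r * w)) ≠ 0 := by
    intro h
    obtain ⟨n, hn⟩ := Real.sin_eq_zero_iff.1 h
    exact hr ⟨n, by field_simp; linarith⟩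
  rw [Real.sin_two_mul] at key
  refine ⟨?_, ?_, ?_⟩ <;> intro h <;> simp [h] at key

lemma glue (f fA fB : ℝ → ℝ) (a s0 D : ℝ) (h1 : ∀ s ≤ a, f s = fA s) (h2 : ∀ s, a ≤ s → f s = fB s)
    (hA : s0 ≤ a → HasDerivAt fA D s0) (hB : a ≤ s0 → HasDerivAt fB D s0) :
    HasDerivAt f D s0 := by
  rcases lt_trichotomy s0 a with h | h | h
  · refine (hA h.le).congr_of_eventuallyEq ?_
    filter_upwards [eventually_lt_nhds h] with s hs using h1 s hs.le
  · subst h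
    have i1 : HasDerivWithinAt f D (Set.Iic s0) s0 :=
      (hA le_rfl).hasDerivWithinAt.congr (fun s hs => h1 s hs) (h1 _ le_rfl)
    have i2 : HasDerivWithinAt f D (Set.Ici s0) s0 :=
      (hB le_rfl).hasDerivWithinAt.congr (fun s hs => h2 s hs) (h2 _ le_rfl)
    have := i1.union i2
    rwa [Set.Iic_union_Ici, hasDerivWithinAt_univ] at this
  · refine (hB h.le).congr_of_eventuallyEq ?_
    filter_upwards [eventually_gt_nhds h] with s hs using h2 s hs.le


def NN (p q w r : ℝ) : ℝ :=
  2 * (Real.cos (r * p) + Real.cos (r * q)) * |Real.cos (r * w)|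
    + 2 * (Real.cos (r * q) - Real.cos (r * p)) * |Real.sin (r * w)| - 4

def ip (p w r : ℝ) : ℝ := -2 * Real.sin (r * p) * (|Real.cos (r * w)| - |Real.sin (r * w)|)

def iq (q w r : ℝ) : ℝ := -2 * Real.sin (r * q) * (|Real.cos (r * w)| + |Real.sin (r * w)|)

def iw (p q w r : ℝ) : ℝ :=
  -2 * (Real.sign (Real.cos (r * w)) * Real.sin (r * w)) * (Real.cos (r * p) + Real.cos (r * q))
    + 2 * (Real.sign (Real.sin (r * w)) * Real.cos (r * w)) * (Real.cos (r * q) - Real.cos (r * p))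

def ipp (p w r : ℝ) : ℝ := -2 * Real.cos (r * p) * (|Real.cos (r * w)| - |Real.sin (r * w)|)

def iqq (q w r : ℝ) : ℝ := -2 * Real.cos (r * q) * (|Real.cos (r * w)| + |Real.sin (r * w)|)

def ipw (p w r : ℝ) : ℝ := 2 * Real.sin (r * p) *
  (Real.sign (Real.cos (r * w)) * Real.sin (r * w) + Real.sign (Real.sin (r * w)) * Real.cos (r * w))

def iqw (q w r : ℝ) : ℝ := 2 * Real.sin (r * q) *
  (Real.sign (Real.cos (r * w)) * Real.sin (r * w) - Real.sign (Real.sin (r * w)) * Real.cos (r * w))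

/-- Gaussian weighted integral. -/
def GI (κ : ℝ) (f : ℝ → ℝ) : ℝ := ∫ r, Real.exp (-κ * r ^ 2) * f r

def JJ (κ p q w : ℝ) : ℝ := GI κ (fun r => NN p q w r / r ^ 2)
def Jp (κ p w : ℝ) : ℝ := GI κ (fun r => ip p w r / r)
def Jq (κ q w : ℝ) : ℝ := GI κ (fun r => iq q w r / r)
def Jw (κ p q w : ℝ) : ℝ := GI κ (fun r => iw p q w r / r)
def Jpp (κ p w : ℝ) : ℝ := GI κ (ipp p w)
def Jqq (κ q w : ℝ) : ℝ := GI κ (iqq q w)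
def Jpw (κ p w : ℝ) : ℝ := GI κ (ipw p w)
def Jqw (κ q w : ℝ) : ℝ := GI κ (iqw q w)

lemma m_s (w : ℝ) : Measurable fun r : ℝ => Real.sign (Real.sin (r * w)) :=
  sgn_meas.comp (by fun_prop)
lemma m_c (w : ℝ) : Measurable fun r : ℝ => Real.sign (Real.cos (r * w)) :=
  sgn_meas.comp (by fun_prop)
lemma m_NN (p q w : ℝ) : Measurable (NN p q w) := by
  unfold NN; fun_prop
lemma m_ip (p w : ℝ) : Measurable (ip p w) := by
  unfold ip; fun_prop
lemma m_iq (p w : ℝ) : Measurable (iq p w) := by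
  unfold iq; fun_prop
lemma m_ipp (p w : ℝ) : Measurable (ipp p w) := by
  unfold ipp; fun_prop
lemma m_iqq (p w : ℝ) : Measurable (iqq p w) := by
  unfold iqq; fun_prop
lemma m_iw (p q w : ℝ) : Measurable (iw p q w) := by
  unfold iw; have := m_s w; have := m_c w; fun_prop
lemma m_ipw (p w : ℝ) : Measurable (ipw p w) := by
  unfold ipw; have := m_s w; have := m_c w; fun_prop
lemma m_iqw (p w : ℝ) : Measurable (iqw p w) := by
  unfold iqw; have := m_s w; have := m_c w; fun_prop

lemma ac (x : ℝ) : |Real.cos x| ≤ 1 := Real.abs_cos_le_one x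
lemma as (x : ℝ) : |Real.sin x| ≤ 1 := Real.abs_sin_le_one x

lemma mul_le1 (a b A : ℝ) (h : |a| ≤ A) (h2 : |b| ≤ 1) : |a * b| ≤ A := by
  rw [abs_mul]
  nlinarith [abs_nonneg a, abs_nonneg b]

lemma b_sc (x y : ℝ) : |Real.sign x * Real.sin y| ≤ 1 := mul_le1 _ _ _ (sgn_abs _) (as _)
lemma b_ss (x y : ℝ) : |Real.sign x * Real.cos y| ≤ 1 := mul_le1 _ _ _ (sgn_abs _) (ac _)

lemma b_add (a b : ℝ) (h : |a| ≤ 1) (h2 : |b| ≤ 1) : |a + b| ≤ 2 := by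
  have := abs_add_le a b; linarith
lemma b_sub (a b : ℝ) (h : |a| ≤ 1) (h2 : |b| ≤ 1) : |a - b| ≤ 2 := by
  have := abs_sub a b; linarith

lemma b_abs (a : ℝ) (h : |a| ≤ 1) : |(|a|)| ≤ 1 := by rwa [abs_abs]

lemma b22 (a b A : ℝ) (h : |a| ≤ A) (h2 : |b| ≤ 2) : |2 * a * b| ≤ 4 * A := by
  rw [abs_mul, abs_mul, abs_two]
  nlinarith [abs_nonneg a, abs_nonneg b]

lemma b_ip (p w r : ℝ) : |ip p w r| ≤ 4 * |r * p| := by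
  unfold ip
  rw [neg_mul, neg_mul, abs_neg]
  exact b22 _ _ _ Real.abs_sin_le_abs (b_sub _ _ (b_abs _ (ac _)) (b_abs _ (as _)))

lemma b_iq (p w r : ℝ) : |iq p w r| ≤ 4 * |r * p| := by
  unfold iq
  rw [neg_mul, neg_mul, abs_neg]
  exact b22 _ _ _ Real.abs_sin_le_abs (b_add _ _ (b_abs _ (ac _)) (b_abs _ (as _)))

lemma b_ipp (p w r : ℝ) : |ipp p w r| ≤ 4 := by
  unfold ipp
  rw [neg_mul, neg_mul, abs_neg]
  simpa using b22 _ _ _ (ac _) (b_sub _ _ (b_abs _ (ac _)) (b_abs _ (as _)))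

lemma b_iqq (p w r : ℝ) : |iqq p w r| ≤ 4 := by
  unfold iqq
  rw [neg_mul, neg_mul, abs_neg]
  simpa using b22 _ _ _ (ac _) (b_add _ _ (b_abs _ (ac _)) (b_abs _ (as _)))

lemma b_ipw (p w r : ℝ) : |ipw p w r| ≤ 4 := by
  unfold ipw
  simpa using b22 _ _ _ (as _) (b_add _ _ (b_sc _ _) (b_ss _ _))

lemma b_iqw (p w r : ℝ) : |iqw p w r| ≤ 4 := by
  unfold iqw
  simpa using b22 _ _ _ (as _) (b_sub _ _ (b_sc _ _) (b_ss _ _))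

lemma b_iw1 (p q w r : ℝ) : |iw p q w r| ≤ 8 := by
  unfold iw
  have h1 := b22 _ _ _ (b_sc (Real.cos (r * w)) (r * w)) (b_add _ _ (ac (r * p)) (ac (r * q)))
  have h2 := b22 _ _ _ (b_ss (Real.sin (r * w)) (r * w)) (b_sub _ _ (ac (r * q)) (ac (r * p)))
  rw [neg_mul, neg_mul]
  refine (abs_add_le _ _).trans ?_
  rw [abs_neg]; linarith

lemma b_iw (p q w r : ℝ) : |iw p q w r| ≤ (4 * |w| + 2 * |q - p|) * |r| := by
  unfold iw
  have h0 : |Real.sign (Real.cos (r * w)) * Real.sin (r * w)| ≤ |r| * |w| := by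
    rw [mul_comm, ← abs_mul]
    exact mul_le1 _ _ _ Real.abs_sin_le_abs (sgn_abs _)
  have h1 := b22 _ _ _ h0 (b_add _ _ (ac (r * p)) (ac (r * q)))
  have h2 : |2 * (Real.sign (Real.sin (r * w)) * Real.cos (r * w)) *
      (Real.cos (r * q) - Real.cos (r * p))| ≤ 2 * |q - p| * |r| := by
    rw [abs_mul, abs_mul, abs_two]
    have i1 := b_ss (Real.sin (r * w)) (r * w)
    have i2 := cosd1 (r * q) (r * p)
    rw [← mul_sub, abs_mul] at i2
    have := mul_le_mul i1 i2 (abs_nonneg _) (by norm_num)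
    linarith
  rw [neg_mul, neg_mul]
  refine (abs_add_le _ _).trans ?_
  rw [abs_neg]; linarith

lemma divb (x r A : ℝ) (hA : 0 ≤ A) (h : |x| ≤ A * |r|) : |x / r| ≤ A + 0 * |r| := by
  rw [abs_div, zero_mul, add_zero]
  exact div_le_of_le_mul₀ (abs_nonneg _) hA h

lemma divb2 (x r A B : ℝ) (h : |x| ≤ (A + B * |r|) * r ^ 2) (h2 : 0 ≤ A + B * |r|) :
    |x / r ^ 2| ≤ A + B * |r| := by
  rw [abs_div, abs_of_nonneg (sq_nonneg r)]
  exact div_le_of_le_mul₀ (by positivity) h2 h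

lemma b_ip' (p w r : ℝ) : |ip p w r / r| ≤ 4 * |p| + 0 * |r| :=
  divb _ _ _ (by positivity) ((b_ip p w r).trans (by rw [abs_mul]; linarith))
lemma b_iq' (p w r : ℝ) : |iq p w r / r| ≤ 4 * |p| + 0 * |r| :=
  divb _ _ _ (by positivity) ((b_iq p w r).trans (by rw [abs_mul]; linarith))
lemma b_iw' (p q w r : ℝ) : |iw p q w r / r| ≤ (4 * |w| + 2 * |q - p|) + 0 * |r| :=
  divb _ _ _ (by positivity) (b_iw p q w r)

lemma m_ip' (p w : ℝ) : Measurable (fun r => ip p w r / r) := (m_ip p w).div measurable_id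
lemma m_iq' (p w : ℝ) : Measurable (fun r => iq p w r / r) := (m_iq p w).div measurable_id
lemma m_iw' (p q w : ℝ) : Measurable (fun r => iw p q w r / r) := (m_iw p q w).div measurable_id

lemma i_of (κ : ℝ) (hκ : 0 < κ) (f : ℝ → ℝ) (hf : Measurable f) (A : ℝ) (h : ∀ r, |f r| ≤ A) :
    Integrable (fun r => Real.exp (-κ * r ^ 2) * f r) :=
  gInt hκ f hf A 0 (fun r => by simpa using h r)

lemma GI_lin3 (κ a b c : ℝ) (f g h : ℝ → ℝ)
    (hf : Integrable (fun r => Real.exp (-κ * r ^ 2) * f r))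
    (hg : Integrable (fun r => Real.exp (-κ * r ^ 2) * g r))
    (hh : Integrable (fun r => Real.exp (-κ * r ^ 2) * h r)) :
    GI κ (fun r => a * f r + b * g r + c * h r) = a * GI κ f + b * GI κ g + c * GI κ h := by
  unfold GI
  rw [← integral_const_mul, ← integral_const_mul, ← integral_const_mul,
    ← integral_add (hf.const_mul a) (hg.const_mul b)]
  have := integral_add ((hf.const_mul a).add (hg.const_mul b)) (hh.const_mul c)
  simp only [Pi.add_apply] at this
  rw [← this]
  congr 1; ext r; ring

lemma GI_lin2 (κ a b : ℝ) (f g : ℝ → ℝ)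
    (hf : Integrable (fun r => Real.exp (-κ * r ^ 2) * f r))
    (hg : Integrable (fun r => Real.exp (-κ * r ^ 2) * g r)) :
    GI κ (fun r => a * f r + b * g r) = a * GI κ f + b * GI κ g := by
  have := GI_lin3 κ a b 0 f g g hf hg hg
  simpa using this

lemma NN_lip (p q w p' q' w' r M d : ℝ) (hM : 0 ≤ M) (_hd : 0 ≤ d) (hp : |p| ≤ M) (hp' : |p'| ≤ M)
    (hq : |q| ≤ M) (hq' : |q'| ≤ M) (hw : |w| ≤ M) (hw' : |w'| ≤ M)
    (dp : |p - p'| ≤ M * d) (dq : |q - q'| ≤ M * d) (dw : |w - w'| ≤ M * d) :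
    |NN p q w r - NN p' q' w' r| ≤ (12 * M ^ 2 + 4 * M ^ 3 * |r|) * r ^ 2 * d := by
  have hc : ∀ a b e, |a| ≤ M → |b| ≤ M → |a - b| ≤ e →
      |Real.cos (r * a) - Real.cos (r * b)| ≤ r ^ 2 * M * e := by
    intro a b e ha hb he
    refine (cosd _ _).trans ?_
    rw [← mul_add, ← mul_sub, abs_mul, abs_mul, ← sq_abs r]
    have h1 : |a + b| ≤ 2 * M := (abs_add_le _ _).trans (by linarith)
    have := mul_le_mul h1 he (abs_nonneg _) (by linarith)
    nlinarith [sq_nonneg |r|]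
  have cp := hc p p' _ hp hp' dp
  have cq := hc q q' _ hq hq' dq
  have cw := (abs_abs_sub_abs_le_abs_sub _ _).trans (hc w w' _ hw hw' dw)
  have cqp := hc q' p' (2 * M) hq' hp' (by have := abs_sub q' p'; linarith)
  have sw : |(|Real.sin (r * w)| - |Real.sin (r * w')|)| ≤ |r| * (M * d) := by
    refine (abs_abs_sub_abs_le_abs_sub _ _).trans ((sind1 _ _).trans ?_)
    rw [← mul_sub, abs_mul]; gcongr
  have e : NN p q w r - NN p' q' w' r =
      2 * ((Real.cos (r * p) - Real.cos (r * p')) * |Real.cos (r * w)|)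
      + 2 * ((Real.cos (r * q) - Real.cos (r * q')) * |Real.cos (r * w)|)
      + 2 * ((|Real.cos (r * w)| - |Real.cos (r * w')|) * Real.cos (r * p'))
      + 2 * ((|Real.cos (r * w)| - |Real.cos (r * w')|) * Real.cos (r * q'))
      + 2 * ((Real.cos (r * q) - Real.cos (r * q')) * |Real.sin (r * w)|)
      - 2 * ((Real.cos (r * p) - Real.cos (r * p')) * |Real.sin (r * w)|)
      + 2 * ((Real.cos (r * q') - Real.cos (r * p')) * (|Real.sin (r * w)| - |Real.sin (r * w')|)) := by
    unfold NN; ring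
  have t1 := abs_le.1 (mul_le1 _ _ _ cp (b_abs _ (ac (r * w))))
  have t2 := abs_le.1 (mul_le1 _ _ _ cq (b_abs _ (ac (r * w))))
  have t3 := abs_le.1 (mul_le1 _ _ _ cw (ac (r * p')))
  have t4 := abs_le.1 (mul_le1 _ _ _ cw (ac (r * q')))
  have t5 := abs_le.1 (mul_le1 _ _ _ cq (b_abs _ (as (r * w))))
  have t6 := abs_le.1 (mul_le1 _ _ _ cp (b_abs _ (as (r * w))))
  have t7 : |(Real.cos (r * q') - Real.cos (r * p')) * (|Real.sin (r * w)| - |Real.sin (r * w')|)|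
     ≤ (r ^ 2 * M * (2 * M)) * (|r| * (M * d)) := by
    rw [abs_mul]; exact mul_le_mul cqp sw (abs_nonneg _) (by positivity)
  have t7 := abs_le.1 t7
  rw [e, abs_le]
  constructor <;> linarith [t1.1, t1.2, t2.1, t2.2, t3.1, t3.2, t4.1, t4.2, t5.1, t5.2, t6.1, t6.2, t7.1, t7.2]

lemma NN_zero (r : ℝ) : NN 0 0 0 r = 0 := by simp [NN]; norm_num
lemma NN_zero' (p q w : ℝ) : NN p q w 0 = 0 := by simp [NN]; norm_num

lemma NN_b (p q w : ℝ) : ∃ A B, 0 ≤ A ∧ 0 ≤ B ∧ ∀ r, |NN p q w r / r ^ 2| ≤ A + B * |r| := by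
  set M := max |p| (max |q| |w|) with hMd
  have h1 : |p| ≤ M := le_max_left _ _
  have h2 : |q| ≤ M := (le_max_left _ _).trans (le_max_right _ _)
  have h3 : |w| ≤ M := (le_max_right _ _).trans (le_max_right _ _)
  have hM : 0 ≤ M := (abs_nonneg _).trans h1
  refine ⟨12 * M ^ 2, 4 * M ^ 3, by positivity, by positivity, fun r => divb2 _ _ _ _ ?_ (by positivity)⟩
  have := NN_lip p q w 0 0 0 r M 1 hM zero_le_one h1 (by simpa) h2 (by simpa) h3 (by simpa)
    (by simpa) (by simpa) (by simpa)
  simpa [NN_zero] using this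

lemma NN_b2 (p q w r : ℝ) : |NN p q w r| ≤ 12 := by
  unfold NN
  have h1 := b22 _ _ _ (b_abs _ (ac (r * w))) (b_add _ _ (ac (r * p)) (ac (r * q)))
  have h2 := b22 _ _ _ (b_abs _ (as (r * w))) (b_sub _ _ (ac (r * q)) (ac (r * p)))
  rw [abs_le] at *
  constructor <;> linarith [h1.1, h1.2, h2.1, h2.2]

/-- admissible points -/
def Good (p q w : ℝ) : Prop := 0 < w ∨ (p = 0 ∧ q = 0 ∧ w = 0)

lemma Good.ae {p q w : ℝ} (h : Good p q w) : ∀ᵐ r : ℝ, r ≠ 0 ∧ Real.cos (r * w) ≠ 0 ∧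
    (Real.sin (r * w) ≠ 0 ∨ (p = 0 ∧ q = 0)) := by
  rcases h with h | ⟨h1, h2, h3⟩
  · filter_upwards [ae_good w h.ne'] with r hr
    tauto
  · filter_upwards [ae_good 1 one_ne_zero] with r hr
    simp [h1, h2, h3, hr.1]

lemma hd_cos {p : ℝ → ℝ} {p1 s0 : ℝ} (hp : HasDerivAt p p1 s0) (r : ℝ) :
    HasDerivAt (fun s => Real.cos (r * p s)) (-Real.sin (r * p s0) * (r * p1)) s0 :=
  (hp.const_mul r).cos
lemma hd_sin {p : ℝ → ℝ} {p1 s0 : ℝ} (hp : HasDerivAt p p1 s0) (r : ℝ) :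
    HasDerivAt (fun s => Real.sin (r * p s)) (Real.cos (r * p s0) * (r * p1)) s0 :=
  (hp.const_mul r).sin

lemma J_deriv {κ : ℝ} (hκ : 0 < κ) (p q w : ℝ → ℝ) (p1 q1 w1 s0 : ℝ) (hp : HasDerivAt p p1 s0)
    (hq : HasDerivAt q q1 s0) (hw : HasDerivAt w w1 s0) (hg : Good (p s0) (q s0) (w s0)) :
    HasDerivAt (fun s => JJ κ (p s) (q s) (w s))
      (p1 * Jp κ (p s0) (w s0) + q1 * Jq κ (q s0) (w s0) + w1 * Jw κ (p s0) (q s0) (w s0)) s0 := by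
  obtain ⟨M, hM, ⟨hp0, hq0, hw0⟩, he⟩ := ctrl3 p q w p1 q1 w1 s0 hp hq hw
  obtain ⟨A, B, hA, hB, hAB⟩ := NN_b (p s0) (q s0) (w s0)
  unfold Jp Jq Jw
  rw [← GI_lin3 _ _ _ _ _ _ _ (gInt hκ _ (m_ip' _ _) _ _ (b_ip' _ _))
    (gInt hκ _ (m_iq' _ _) _ _ (b_iq' _ _))
    (gInt hκ _ (m_iw' _ _ _) _ _ (b_iw' _ _ _))]
  refine gDeriv hκ (fun s r => NN (p s) (q s) (w s) r / r ^ 2) _ s0 (A + 12 * M ^ 2)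
    (B + 4 * M ^ 3) (fun s => ?_) ?_ (fun r => ?_) ?_ ?_
  · have := m_NN (p s) (q s) (w s); fun_prop
  · have := m_ip (p s0) (w s0); have := m_iq (q s0) (w s0); have := m_iw (p s0) (q s0) (w s0)
    fun_prop
  · refine (hAB r).trans ?_
    have : 0 ≤ 12 * M ^ 2 := by positivity
    have : 0 ≤ 4 * M ^ 3 := by positivity
    gcongr <;> linarith
  · filter_upwards [he] with s hs r
    rw [← sub_div]
    have := NN_lip _ _ _ _ _ _ r M |s - s0| hM (abs_nonneg _) hs.1.1 hp0 hs.2.1.1 hq0 hs.2.2.1 hw0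
      hs.1.2 hs.2.1.2 hs.2.2.2
    rw [abs_div, abs_of_nonneg (sq_nonneg r)]
    refine div_le_of_le_mul₀ (by positivity) (by positivity) (this.trans ?_)
    have : 0 ≤ (A + B * |r|) * |s - s0| * r ^ 2 := by positivity
    linarith
  · filter_upwards [hg.ae] with r ⟨hr, h1, h2⟩
    have d1 := mulabs _ _ _ _ _ ((hd_cos hp r).add (hd_cos hq r)) (hd_cos hw r) (Or.inl h1)
    have d2 := mulabs _ _ _ _ _ ((hd_cos hq r).sub (hd_cos hp r)) (hd_sin hw r)
      (h2.imp id (fun h => by simp [h.1, h.2]))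
    have d := (((d1.const_mul 2).add (d2.const_mul 2)).sub_const 4).div_const (r ^ 2)
    refine (d.congr_deriv ?_).congr_of_eventuallyEq ?_
    · unfold ip iq iw; simp only [Pi.add_apply, Pi.sub_apply]; field_simp; ring
    · refine Eventually.of_forall fun s => ?_
      simp only [NN, Pi.add_apply, Pi.sub_apply]; ring


lemma ip_lip (c1 c2 p w p' w' r M d : ℝ) (h1 : |c1| ≤ 1) (h2 : |c2| ≤ 1)
    (dp : |p - p'| ≤ M * d) (dw : |w - w'| ≤ M * d) :
    |2 * Real.sin (r * p) * (c1 * |Real.cos (r * w)| + c2 * |Real.sin (r * w)|)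
      - 2 * Real.sin (r * p') * (c1 * |Real.cos (r * w')| + c2 * |Real.sin (r * w')|)|
      ≤ 8 * M * d * |r| := by
  have sp : |Real.sin (r * p) - Real.sin (r * p')| ≤ |r| * (M * d) := by
    refine (sind1 _ _).trans ?_
    rw [← mul_sub, abs_mul]; gcongr
  have sw : |(|Real.sin (r * w)| - |Real.sin (r * w')|)| ≤ |r| * (M * d) := by
    refine (abs_abs_sub_abs_le_abs_sub _ _).trans ((sind1 _ _).trans ?_)
    rw [← mul_sub, abs_mul]; gcongr
  have cw : |(|Real.cos (r * w)| - |Real.cos (r * w')|)| ≤ |r| * (M * d) := by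
    refine (abs_abs_sub_abs_le_abs_sub _ _).trans ((cosd1 _ _).trans ?_)
    rw [← mul_sub, abs_mul]; gcongr
  have e : 2 * Real.sin (r * p) * (c1 * |Real.cos (r * w)| + c2 * |Real.sin (r * w)|)
      - 2 * Real.sin (r * p') * (c1 * |Real.cos (r * w')| + c2 * |Real.sin (r * w')|) =
      2 * ((Real.sin (r * p) - Real.sin (r * p')) * |Real.cos (r * w)| * c1)
      + 2 * ((Real.sin (r * p) - Real.sin (r * p')) * |Real.sin (r * w)| * c2)
      + 2 * ((|Real.cos (r * w)| - |Real.cos (r * w')|) * Real.sin (r * p') * c1)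
      + 2 * ((|Real.sin (r * w)| - |Real.sin (r * w')|) * Real.sin (r * p') * c2) := by ring
  have t1 := abs_le.1 (mul_le1 _ _ _ (mul_le1 _ _ _ sp (b_abs _ (ac (r * w)))) h1)
  have t2 := abs_le.1 (mul_le1 _ _ _ (mul_le1 _ _ _ sp (b_abs _ (as (r * w)))) h2)
  have t3 := abs_le.1 (mul_le1 _ _ _ (mul_le1 _ _ _ cw (as (r * p'))) h1)
  have t4 := abs_le.1 (mul_le1 _ _ _ (mul_le1 _ _ _ sw (as (r * p'))) h2)
  rw [e, abs_le]
  constructor <;> linarith [t1.1, t1.2, t2.1, t2.2, t3.1, t3.2, t4.1, t4.2]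

lemma Jp_deriv {κ : ℝ} (hκ : 0 < κ) (p w : ℝ → ℝ) (p1 w1 s0 q0 : ℝ) (hp : HasDerivAt p p1 s0)
    (hw : HasDerivAt w w1 s0) (hg : Good (p s0) q0 (w s0)) :
    HasDerivAt (fun s => Jp κ (p s) (w s))
      (p1 * Jpp κ (p s0) (w s0) + w1 * Jpw κ (p s0) (w s0)) s0 := by
  obtain ⟨M, hM, ⟨hp0, _, hw0⟩, he⟩ := ctrl3 p p w p1 p1 w1 s0 hp hp hw
  unfold Jpp Jpw
  rw [← GI_lin2 _ _ _ _ _ (i_of κ hκ _ (m_ipp _ _) _ (b_ipp _ _))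
    (i_of κ hκ _ (m_ipw _ _) _ (b_ipw _ _))]
  refine gDeriv hκ (fun s r => ip (p s) (w s) r / r) _ s0 (4 * |p s0| + 8 * M)
    0 (fun s => m_ip' _ _) ?_ (fun r => ?_) ?_ ?_
  · have := m_ipp (p s0) (w s0); have := m_ipw (p s0) (w s0)
    fun_prop
  · have := b_ip' (p s0) (w s0) r
    linarith
  · filter_upwards [he] with s hs r
    rw [← sub_div]
    have := ip_lip (-1) 1 _ _ _ _ r M |s - s0| (by simp) (by simp) hs.1.2 hs.2.2.2
    rw [abs_div]
    refine div_le_of_le_mul₀ (by positivity) (by positivity) ?_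
    have e : ip (p s) (w s) r - ip (p s0) (w s0) r = 
      2 * Real.sin (r * p s) * (-1 * |Real.cos (r * w s)| + 1 * |Real.sin (r * w s)|)
      - 2 * Real.sin (r * p s0) * (-1 * |Real.cos (r * w s0)| + 1 * |Real.sin (r * w s0)|) := by
      unfold ip; ring
    rw [e]
    refine this.trans ?_
    have : 0 ≤ 4 * |p s0| * |s - s0| * |r| := by positivity
    linarith
  · filter_upwards [hg.ae] with r ⟨hr, h1, h2⟩
    have d1 := mulabs _ _ _ _ _ (hd_sin hp r) (hd_cos hw r) (Or.inl h1)
    have d2 := mulabs _ _ _ _ _ (hd_sin hp r) (hd_sin hw r)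
      (h2.imp id (fun h => by simp [h.1]))
    have d := ((d1.const_mul (-2)).add (d2.const_mul 2)).div_const r
    refine (d.congr_deriv ?_).congr_of_eventuallyEq ?_
    · unfold ipp ipw; field_simp; ring
    · refine Eventually.of_forall fun s => ?_
      simp only [ip, Pi.add_apply]; ring

lemma Jq_deriv {κ : ℝ} (hκ : 0 < κ) (p w : ℝ → ℝ) (p1 w1 s0 q0 : ℝ) (hp : HasDerivAt p p1 s0)
    (hw : HasDerivAt w w1 s0) (hg : Good q0 (p s0) (w s0)) :
    HasDerivAt (fun s => Jq κ (p s) (w s))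
      (p1 * Jqq κ (p s0) (w s0) + w1 * Jqw κ (p s0) (w s0)) s0 := by
  obtain ⟨M, hM, ⟨hp0, _, hw0⟩, he⟩ := ctrl3 p p w p1 p1 w1 s0 hp hp hw
  unfold Jqq Jqw
  rw [← GI_lin2 _ _ _ _ _ (i_of κ hκ _ (m_iqq _ _) _ (b_iqq _ _))
    (i_of κ hκ _ (m_iqw _ _) _ (b_iqw _ _))]
  refine gDeriv hκ (fun s r => iq (p s) (w s) r / r) _ s0 (4 * |p s0| + 8 * M)
    0 (fun s => m_iq' _ _) ?_ (fun r => ?_) ?_ ?_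
  · have := m_iqq (p s0) (w s0); have := m_iqw (p s0) (w s0)
    fun_prop
  · have := b_iq' (p s0) (w s0) r
    linarith
  · filter_upwards [he] with s hs r
    rw [← sub_div]
    have := ip_lip (-1) (-1) _ _ _ _ r M |s - s0| (by simp) (by simp) hs.1.2 hs.2.2.2
    rw [abs_div]
    refine div_le_of_le_mul₀ (by positivity) (by positivity) ?_
    have e : iq (p s) (w s) r - iq (p s0) (w s0) r = 
      2 * Real.sin (r * p s) * (-1 * |Real.cos (r * w s)| + -1 * |Real.sin (r * w s)|)
      - 2 * Real.sin (r * p s0) * (-1 * |Real.cos (r * w s0)| + -1 * |Real.sin (r * w s0)|) := by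
      unfold iq; ring
    rw [e]
    refine this.trans ?_
    have : 0 ≤ 4 * |p s0| * |s - s0| * |r| := by positivity
    linarith
  · filter_upwards [hg.ae] with r ⟨hr, h1, h2⟩
    have d1 := mulabs _ _ _ _ _ (hd_sin hp r) (hd_cos hw r) (Or.inl h1)
    have d2 := mulabs _ _ _ _ _ (hd_sin hp r) (hd_sin hw r)
      (h2.imp id (fun h => by simp [h.2]))
    have d := ((d1.const_mul (-2)).add (d2.const_mul (-2))).div_const r
    refine (d.congr_deriv ?_).congr_of_eventuallyEq ?_
    · unfold iqq iqw; field_simp; ring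
    · refine Eventually.of_forall fun s => ?_
      simp only [iq, Pi.add_apply]; ring

lemma bdmul (f g : ℝ → ℝ) (s0 C : ℝ) (hf : HasDerivAt f 0 s0) (h0 : f s0 = 0)
    (hg : ∀ s, |g s| ≤ C) : HasDerivAt (fun s => g s * f s) 0 s0 := by
  rw [hasDerivAt_iff_isLittleO] at hf ⊢
  simp only [h0, mul_zero, smul_zero, sub_zero] at hf ⊢
  have h1 : g =O[𝓝 s0] (fun _ => (1 : ℝ)) :=
    Asymptotics.IsBigO.of_bound C (Eventually.of_forall fun s => by simpa using hg s)
  simpa using h1.mul_isLittleO hf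

lemma Jw_deriv0 {κ : ℝ} (hκ : 0 < κ) (p q w : ℝ → ℝ) (p1 q1 w1 s0 : ℝ) (hp : HasDerivAt p p1 s0)
    (hq : HasDerivAt q q1 s0) (hw : HasDerivAt w w1 s0) (p0 : p s0 = 0) (q0 : q s0 = 0)
    (w0 : w s0 = 0) :
    HasDerivAt (fun s => Jw κ (p s) (q s) (w s)) (w1 * GI κ (fun _ => -4)) s0 := by
  obtain ⟨M, hM, -, he⟩ := ctrl3 p q w p1 q1 w1 s0 hp hq hw
  have e : w1 * GI κ (fun _ => -4) = GI κ (fun _ => w1 * (-4)) := by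
    unfold GI; rw [← integral_const_mul]; congr 1; ext r; ring
  rw [e]
  have z : ∀ r, iw (p s0) (q s0) (w s0) r = 0 := by intro r; simp [iw, p0, q0, w0]
  refine gDeriv hκ (fun s r => iw (p s) (q s) (w s) r / r) _ s0 (8 * M)
    0 (fun s => m_iw' _ _ _) measurable_const (fun r => ?_) ?_ ?_
  · simp only [z]; simpa
  · filter_upwards [he] with s hs r
    simp only [z, zero_div, sub_zero]
    refine (b_iw' _ _ _ r).trans ?_
    have h1 := hs.1.2
    have h2 := hs.2.1.2
    have h3 := hs.2.2.2
    rw [p0, sub_zero] at h1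
    rw [q0, sub_zero] at h2
    rw [w0, sub_zero] at h3
    have := abs_sub (q s) (p s)
    linarith
  · filter_upwards [ae_good 1 one_ne_zero] with r hr'
    have hr := hr'.1
    have d1 := (((hd_sin hw r).const_mul (-2)).mul ((hd_cos hp r).add (hd_cos hq r)))
    have d2 : HasDerivAt (fun s => (Real.sign (Real.sin (r * w s)) * Real.cos (r * w s)) *
        (Real.cos (r * q s) - Real.cos (r * p s))) 0 s0 := by
      refine bdmul _ _ s0 1 ?_ ?_ (fun s => b_ss _ _)
      · refine ((hd_cos hq r).sub (hd_cos hp r)).congr_deriv ?_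
        simp [p0, q0]
      · simp [p0, q0]
    have d := (d1.add (d2.const_mul 2)).div_const r
    refine (d.congr_deriv ?_).congr_of_eventuallyEq ?_
    · simp [p0, q0, w0]; field_simp; ring
    · have hc : ∀ᶠ s in 𝓝 s0, 0 < Real.cos (r * w s) :=
        continuousAt_const.eventually_lt (hd_cos hw r).continuousAt (by simp [w0])
      filter_upwards [hc] with s hs
      simp only [iw, Real.sign_of_pos hs, Pi.add_apply, Pi.mul_apply]; ring

lemma GI_scale (κ w : ℝ) (hw : 0 < w) (f g : ℝ → ℝ) (c : ℝ) (h : ∀ r, g (w * r) = c * f r) :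
    GI (κ / w ^ 2) g = w * (c * GI κ f) := by
  unfold GI
  have := Measure.integral_comp_mul_left (fun a => Real.exp (-(κ / w ^ 2) * a ^ 2) * g a) w
  rw [abs_of_pos (inv_pos.2 hw), smul_eq_mul] at this
  rw [inv_mul_eq_div, eq_div_iff hw.ne'] at this
  rw [← this, mul_comm, ← integral_const_mul c]
  congr 2; funext r
  rw [h]
  have : -(κ / w ^ 2) * (w * r) ^ 2 = -κ * r ^ 2 := by field_simp
  rw [this]; ring

lemma GI_split (k l : ℝ) (f : ℝ → ℝ) : GI l f =
    ∫ r, Real.exp (-k * r ^ 2) * (Real.exp (-((l - k) * r ^ 2)) * f r) := by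
  unfold GI
  congr 1; ext r
  rw [← mul_assoc, ← Real.exp_add]; congr 2; ring

lemma H_deriv (l m n : ℝ → ℝ) (l1 m1 n1 s0 : ℝ) (hl : HasDerivAt l l1 s0)
    (hm : HasDerivAt m m1 s0) (hn : HasDerivAt n n1 s0) (hpos : 0 < l s0) :
    HasDerivAt (fun s => GI (l s) (fun a => iw (m s) (n s) 1 a / a))
      (l1 * GI (l s0) (fun a => - a * iw (m s0) (n s0) 1 a) + m1 * GI (l s0) (ipw (m s0) 1)
        + n1 * GI (l s0) (iqw (n s0) 1)) s0 := by
  obtain ⟨M, hM, -, he⟩ := ctrl3 l m n l1 m1 n1 s0 hl hm hn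
  set k := l s0 / 2 with hk
  have hk0 : 0 < k := by positivity
  have hev : ∀ᶠ s in 𝓝 s0, k < l s :=
    continuousAt_const.eventually_lt hl.continuousAt (by linarith)
  rw [← GI_lin3]
  rotate_left
  · refine gInt hpos _ (measurable_id.neg.mul (m_iw _ _ _)) 0 8 (fun r => ?_)
    rw [abs_mul, abs_neg]
    have := b_iw1 (m s0) (n s0) 1 r
    nlinarith [abs_nonneg r]
  · exact i_of _ hpos _ (m_ipw _ _) _ (b_ipw _ _)
  · exact i_of _ hpos _ (m_iqw _ _) _ (b_iqw _ _)
  rw [GI_split k]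
  simp only [GI_split k (l _)]
  have hA : 0 ≤ 4 * |(1 : ℝ)| + 2 * |n s0 - m s0| := by positivity
  refine gDeriv hk0 (fun s a => Real.exp (-((l s - k) * a ^ 2)) * (iw (m s) (n s) 1 a / a)) _ s0
    (4 * |(1 : ℝ)| + 2 * |n s0 - m s0| + 8 * M) (8 * M) (fun s => ?_) ?_ (fun r => ?_) ?_ ?_
  · have := m_iw' (m s) (n s) 1; fun_prop
  · have := m_iw (m s0) (n s0) 1; have := m_ipw (m s0) 1; have := m_iqw (n s0) 1; fun_prop
  · have h1 := b_iw' (m s0) (n s0) 1 r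
    have h2 : |Real.exp (-((l s0 - k) * r ^ 2))| ≤ 1 := by
      rw [Real.abs_exp, Real.exp_le_one_iff]
      have : 0 ≤ (l s0 - k) * r ^ 2 := mul_nonneg (by linarith) (sq_nonneg _)
      linarith
    rw [mul_comm]
    refine (mul_le1 _ _ _ h1 h2).trans ?_
    have : 0 ≤ 8 * M * |r| := by positivity
    linarith
  · filter_upwards [he, hev] with s hs hk r
    have hx : 0 ≤ (l s - k) * r ^ 2 := mul_nonneg (by linarith) (sq_nonneg _)
    have hy : 0 ≤ (l s0 - k) * r ^ 2 := mul_nonneg (by linarith) (sq_nonneg _)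
    have e1 := expd _ _ hx hy
    rw [← sub_mul, abs_mul, abs_of_nonneg (sq_nonneg r), sub_sub_sub_cancel_right] at e1
    have e2 : |Real.exp (-((l s - k) * r ^ 2))| ≤ 1 := by
      rw [Real.abs_exp, Real.exp_le_one_iff]; linarith
    have cm : |Real.cos (r * m s) - Real.cos (r * m s0)| ≤ M * |s - s0| * |r| := by
      refine (cosd1 _ _).trans ?_
      rw [← mul_sub, abs_mul, mul_comm]; gcongr; exact hs.2.1.2
    have cn : |Real.cos (r * n s) - Real.cos (r * n s0)| ≤ M * |s - s0| * |r| := by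
      refine (cosd1 _ _).trans ?_
      rw [← mul_sub, abs_mul, mul_comm]; gcongr; exact hs.2.2.2
    have e3 : |iw (m s) (n s) 1 r - iw (m s0) (n s0) 1 r| ≤ 8 * M * |s - s0| * |r| := by
      have e : iw (m s) (n s) 1 r - iw (m s0) (n s0) 1 r =
        -2 * ((Real.cos (r * m s) - Real.cos (r * m s0)) * (Real.sign (Real.cos (r * 1)) * Real.sin (r * 1)))
        + -2 * ((Real.cos (r * n s) - Real.cos (r * n s0)) * (Real.sign (Real.cos (r * 1)) * Real.sin (r * 1)))
        + 2 * ((Real.cos (r * n s) - Real.cos (r * n s0)) * (Real.sign (Real.sin (r * 1)) * Real.cos (r * 1)))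
        + -2 * ((Real.cos (r * m s) - Real.cos (r * m s0)) * (Real.sign (Real.sin (r * 1)) * Real.cos (r * 1))) := by
        unfold iw; ring
      have t1 := abs_le.1 (mul_le1 _ _ _ cm (b_sc (Real.cos (r * 1)) (r * 1)))
      have t2 := abs_le.1 (mul_le1 _ _ _ cn (b_sc (Real.cos (r * 1)) (r * 1)))
      have t3 := abs_le.1 (mul_le1 _ _ _ cn (b_ss (Real.sin (r * 1)) (r * 1)))
      have t4 := abs_le.1 (mul_le1 _ _ _ cm (b_ss (Real.sin (r * 1)) (r * 1)))
      rw [e, abs_le]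
      constructor <;> linarith [t1.1, t1.2, t2.1, t2.2, t3.1, t3.2, t4.1, t4.2]
    have e3' := divb _ r _ (by positivity) e3
    rw [sub_div] at e3'
    have e4 : r ^ 2 * |iw (m s0) (n s0) 1 r / r| ≤ 8 * |r| := by
      rcases eq_or_ne r 0 with h | h
      · simp [h]
      · rw [abs_div, ← sq_abs r]
        have := b_iw1 (m s0) (n s0) 1 r
        have hr : 0 < |r| := abs_pos.2 h
        field_simp
        exact this
    have e5 : |(iw (m s) (n s) 1 r / r - iw (m s0) (n s0) 1 r / r) *
       Real.exp (-((l s - k) * r ^ 2))| ≤ _ := mul_le1 _ _ _ e3' e2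
    have e6 : |(Real.exp (-((l s - k) * r ^ 2)) - Real.exp (-((l s0 - k) * r ^ 2))) *
        (iw (m s0) (n s0) 1 r / r)| ≤ M * |s - s0| * (8 * |r|) := by
      rw [abs_mul]
      calc _ ≤ (|l s - l s0| * r ^ 2) * |iw (m s0) (n s0) 1 r / r| := by gcongr
        _ = |l s - l s0| * (r ^ 2 * |iw (m s0) (n s0) 1 r / r|) := by ring
        _ ≤ _ := mul_le_mul hs.1.2 e4 (by positivity) (by positivity)
    have := abs_add_le _ _ |>.trans (add_le_add e5 e6)
    have e7 : 0 ≤ (4 * |(1 : ℝ)| + 2 * |n s0 - m s0|) * |s - s0| := by positivity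
    refine le_trans (le_of_eq ?_) (this.trans ?_)
    · congr 1; ring
    · linarith
  · filter_upwards [ae_good 1 one_ne_zero] with r hr'
    have hr := hr'.1
    have d0 := (((hl.sub_const k).mul_const (r ^ 2)).neg).exp
    have d1 := ((hd_cos hm r).add (hd_cos hn r)).const_mul
      (-2 * (Real.sign (Real.cos (r * 1)) * Real.sin (r * 1)))
    have d2 := ((hd_cos hn r).sub (hd_cos hm r)).const_mul
      (2 * (Real.sign (Real.sin (r * 1)) * Real.cos (r * 1)))
    have d := d0.mul ((d1.add d2).div_const r)
    refine (d.congr_deriv ?_).congr_of_eventuallyEq ?_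
    · simp only [iw, ipw, iqw, Pi.add_apply, Pi.sub_apply, Pi.neg_apply]; field_simp; ring
    · refine Eventually.of_forall fun s => ?_
      simp only [iw, Pi.add_apply, Pi.sub_apply, Pi.mul_apply, Pi.neg_apply]

lemma Jw_deriv {κ : ℝ} (hκ : 0 < κ) (p0 q0 w0 : ℝ) (hg : Good p0 q0 w0) :
    ∃ D, ∀ (p q w : ℝ → ℝ) (p1 q1 w1 s0 : ℝ), HasDerivAt p p1 s0 →
      HasDerivAt q q1 s0 → HasDerivAt w w1 s0 → p s0 = p0 → q s0 = q0 → w s0 = w0 →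
      HasDerivAt (fun s => Jw κ (p s) (q s) (w s))
        (p1 * Jpw κ p0 w0 + q1 * Jqw κ q0 w0 + w1 * D) s0 := by
  rcases hg with hw0 | ⟨h1, h2, h3⟩
  · refine ⟨-2 * κ / w0 ^ 3 * GI (κ / w0 ^ 2) (fun a => - a * iw (p0 / w0) (q0 / w0) 1 a)
      - p0 / w0 * Jpw κ p0 w0 - q0 / w0 * Jqw κ q0 w0, ?_⟩
    intro p q w p1 q1 w1 s0 hp hq hw ep eq ew
    have hw0' : w s0 ≠ 0 := by rw [ew]; exact hw0.ne'
    have hl := (hasDerivAt_const s0 κ).div (hw.pow 2) (pow_ne_zero 2 hw0')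
    have hm := hp.div hw hw0'
    have hn := hq.div hw hw0'
    have H := H_deriv _ _ _ _ _ _ s0 hl hm hn (by simp [ew]; positivity)
    have s1 := GI_scale κ w0 hw0 (ipw p0 w0) (ipw (p0 / w0) 1) 1 (fun r => by
      have e1 : w0 * r * 1 = r * w0 := by ring
      have e2 : w0 * r * (p0 / w0) = r * p0 := by field_simp
      simp only [ipw, e1, e2, one_mul])
    have s2 := GI_scale κ w0 hw0 (iqw q0 w0) (iqw (q0 / w0) 1) 1 (fun r => by
      have e1 : w0 * r * 1 = r * w0 := by ring
      have e2 : w0 * r * (q0 / w0) = r * q0 := by field_simp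
      simp only [iqw, e1, e2, one_mul])
    have hev : ∀ᶠ s in 𝓝 s0, 0 < w s :=
      continuousAt_const.eventually_lt hw.continuousAt (by rw [ew]; exact hw0)
    refine (H.congr_deriv ?_).congr_of_eventuallyEq ?_
    · simp only [Pi.div_apply, Pi.pow_apply, ep, eq, ew, s1, s2, Jpw, Jqw]
      generalize GI (κ / w0 ^ 2) _ = X
      field_simp
      ring
    · filter_upwards [hev] with s hs
      simp only [Pi.div_apply, Pi.pow_apply]
      rw [GI_scale κ (w s) hs (fun r => iw (p s) (q s) (w s) r / r) _ (w s)⁻¹]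
      · rw [Jw]; field_simp
      · intro r
        have : iw (p s / w s) (q s / w s) 1 (w s * r) = iw (p s) (q s) (w s) r := by
          have e1 : w s * r * 1 = r * w s := by ring
          have e2 : w s * r * (p s / w s) = r * p s := by field_simp
          have e3 : w s * r * (q s / w s) = r * q s := by field_simp
          simp only [iw, e1, e2, e3]
        rw [this, div_mul_eq_div_div, div_eq_inv_mul (iw _ _ _ _) (w s), mul_div_assoc]
  · refine ⟨GI κ (fun _ => -4), ?_⟩
    intro p q w p1 q1 w1 s0 hp hq hw ep eq ew
    refine (Jw_deriv0 hκ p q w p1 q1 w1 s0 hp hq hw (ep.trans h1) (eq.trans h2) (ew.trans h3)).congr_deriv ?_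
    have : ipw p0 w0 = fun _ => 0 := by ext r; simp [ipw, h1]
    have h' : iqw q0 w0 = fun _ => 0 := by ext r; simp [iqw, h2]
    simp [Jpw, Jqw, this, h', GI]

lemma Jt_deriv {κ : ℝ} (hκ : 0 < κ) (p q w : ℝ) :
    HasDerivAt (fun s => JJ s p q w) (-GI κ (NN p q w)) κ := by
  obtain ⟨A, B, hA, hB, hAB⟩ := NN_b p q w
  have e : -GI κ (NN p q w) = GI κ (fun r => - NN p q w r) := by
    unfold GI; rw [← integral_neg]; congr 1; ext r; ring
  rw [e, GI_split (κ / 2)]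
  simp only [JJ, GI_split (κ / 2) _ (fun r => NN p q w r / r ^ 2)]
  refine gDeriv (half_pos hκ) (fun s r => Real.exp (-((s - κ / 2) * r ^ 2)) * (NN p q w r / r ^ 2)) _ κ
    (A + 12) B (fun s => ?_) ?_ (fun r => ?_) ?_ ?_
  · have := m_NN p q w; fun_prop
  · have := m_NN p q w; fun_prop
  · have h2 : |Real.exp (-((κ - κ / 2) * r ^ 2))| ≤ 1 := by
      rw [Real.abs_exp, Real.exp_le_one_iff]
      have : 0 ≤ (κ - κ / 2) * r ^ 2 := mul_nonneg (by linarith) (sq_nonneg _)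
      linarith
    rw [mul_comm]
    refine (mul_le1 _ _ _ (hAB r) h2).trans ?_
    linarith
  · filter_upwards [eventually_gt_nhds (half_lt_self hκ)] with s hs r
    have hx : 0 ≤ (s - κ / 2) * r ^ 2 := mul_nonneg (by linarith) (sq_nonneg _)
    have hy : 0 ≤ (κ - κ / 2) * r ^ 2 := mul_nonneg (by linarith) (sq_nonneg _)
    have e1 := expd _ _ hx hy
    rw [← sub_mul, abs_mul, abs_of_nonneg (sq_nonneg r), sub_sub_sub_cancel_right] at e1
    rw [← sub_mul, abs_mul]
    have e4 : r ^ 2 * |NN p q w r / r ^ 2| ≤ 12 := by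
      rcases eq_or_ne r 0 with h | h
      · simp [h]
      · rw [abs_div, abs_of_nonneg (sq_nonneg r)]
        have := NN_b2 p q w r
        field_simp
        exact this
    calc _ ≤ (|s - κ| * r ^ 2) * |NN p q w r / r ^ 2| := by gcongr
      _ = |s - κ| * (r ^ 2 * |NN p q w r / r ^ 2|) := by ring
      _ ≤ |s - κ| * 12 := by gcongr
      _ ≤ _ := by
        have : 0 ≤ (A + B * |r|) * |s - κ| := by positivity
        linarith
  · filter_upwards [ae_good 1 one_ne_zero] with r hr'
    have hr := hr'.1
    have d0 := (((((hasDerivAt_id κ).sub_const (κ / 2)).mul_const (r ^ 2)).neg).exp).mul_const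
      (NN p q w r / r ^ 2)
    refine d0.congr_deriv ?_
    simp; field_simp


lemma neumann {κ : ℝ} (hκ : 0 < κ) (p q w : ℝ) (h : w = (p + q) / 2) :
    Jw κ p q w = Jp κ p w + Jq κ q w := by
  have := GI_lin2 κ 1 1 _ _ (gInt hκ _ (m_ip' p w) _ _ (b_ip' _ _))
    (gInt hκ _ (m_iq' q w) _ _ (b_iq' _ _))
  rw [one_mul, one_mul] at this
  rw [Jp, Jq, ← this, Jw]
  congr 1; funext r
  obtain ⟨d, rfl⟩ : ∃ d, p = w + d := ⟨p - w, by ring⟩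
  obtain rfl : q = w - d := by linarith
  simp only [iw, ip, iq, ← sgn_mul, mul_add, mul_sub r w d, Real.cos_add, Real.sin_add,
    Real.cos_sub, Real.sin_sub]
  ring

lemma matching {κ : ℝ} (hκ : 0 < κ) (p q w : ℝ) (h : w = (p + q) / 2) :
    Jpp κ p w - Jpw κ p w = Jqq κ q w - Jqw κ q w := by
  have h1 := GI_lin2 κ 1 (-1) _ _ (i_of κ hκ _ (m_ipp p w) _ (b_ipp _ _))
    (i_of κ hκ _ (m_ipw p w) _ (b_ipw _ _))
  have h2 := GI_lin2 κ 1 (-1) _ _ (i_of κ hκ _ (m_iqq q w) _ (b_iqq _ _))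
    (i_of κ hκ _ (m_iqw q w) _ (b_iqw _ _))
  have : GI κ (fun r => 1 * ipp p w r + -1 * ipw p w r)
      = GI κ (fun r => 1 * iqq q w r + -1 * iqw q w r) := by
    congr 1; funext r
    obtain ⟨d, rfl⟩ : ∃ d, p = w + d := ⟨p - w, by ring⟩
    obtain rfl : q = w - d := by linarith
    simp only [ipp, iqq, ipw, iqw, ← sgn_mul, mul_add, mul_sub r w d, Real.cos_add, Real.sin_add,
      Real.cos_sub, Real.sin_sub]
    ring
  rw [h1, h2] at this
  simp only [Jpp, Jpw, Jqq, Jqw]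
  linarith

lemma Jqw_zero (κ w : ℝ) : Jqw κ 0 w = 0 := by simp [Jqw, GI, iqw]

lemma Jw_even_q (κ p q w : ℝ) : Jw κ p (-q) w = Jw κ p q w := by simp [Jw, iw]
lemma Jw_even_p (κ p q w : ℝ) : Jw κ (-p) q w = Jw κ p q w := by simp [Jw, iw]
lemma Jq_odd (κ q w : ℝ) : Jq κ (-q) w = - Jq κ q w := by
  unfold Jq GI; rw [← integral_neg]; congr 1; funext r
  simp only [iq, mul_neg, Real.sin_neg]; ring
lemma JJ_even_q (κ p q w : ℝ) : JJ κ p (-q) w = JJ κ p q w := by simp [JJ, NN]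
lemma JJ_even_p (κ p q w : ℝ) : JJ κ (-p) q w = JJ κ p q w := by simp [JJ, NN]

lemma NN_int {κ : ℝ} (hκ : 0 < κ) (p q w : ℝ) :
    GI κ (NN p q w) = -(Jpp κ p w + Jqq κ q w) - 4 * Real.sqrt (Real.pi / κ) := by
  have h := GI_lin3 κ (-1) (-1) (-4) _ _ (fun _ => 1) (i_of κ hκ _ (m_ipp p w) _ (b_ipp _ _))
    (i_of κ hκ _ (m_iqq q w) _ (b_iqq _ _)) (i_of κ hκ _ measurable_const 1 (by simp))
  have e : NN p q w = fun r => -1 * ipp p w r + -1 * iqq q w r + -4 * 1 := by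
    funext r; simp only [NN, ipp, iqq]; ring
  rw [e, h]
  have : GI κ (fun _ => 1) = Real.sqrt (Real.pi / κ) := by
    simp only [GI, mul_one]; exact integral_gaussian κ
  rw [this, Jpp, Jqq]; ring

lemma Lam_eq (r : ℝ) (y : Fin 4 → ℝ) : Lam r y =
    NN (y 1 - y 0) (y 3 - y 2) ((y 2 + y 3 - y 0 - y 1) / 2) (Real.sqrt 2 * r) := by
  have h2 : Real.sqrt 2 * Real.sqrt 2 = 2 := Real.mul_self_sqrt (by norm_num)
  have h0 : Real.sqrt 2 ≠ 0 := by positivity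
  have inv : 1 / Real.sqrt 2 = Real.sqrt 2 / 2 := by field_simp; linarith
  have inv3 : 3 / Real.sqrt 2 = 3 * (Real.sqrt 2 / 2) := by rw [← inv]; ring
  set ρ := Real.sqrt 2 * r with hρ
  obtain ⟨P, hP⟩ : ∃ P, P = y 1 - y 0 := ⟨_, rfl⟩
  obtain ⟨Q, hQ⟩ : ∃ Q, Q = y 3 - y 2 := ⟨_, rfl⟩
  obtain ⟨W, hW⟩ : ∃ W, W = (y 2 + y 3 - y 0 - y 1) / 2 := ⟨_, rfl⟩
  have t : r * dot theta y = -(ρ * W) := by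
    simp [dot, theta, Fin.sum_univ_four, hρ, hW, -one_div, inv]; ring
  have a0 : r * dot (alph 0) y = -(ρ * P + ρ * W) := by
    simp [dot, alph, Fin.sum_univ_four, hρ, hW, hP, -one_div, inv, inv3]; ring
  have a1 : r * dot (alph 1) y = ρ * P - ρ * W := by
    simp [dot, alph, Fin.sum_univ_four, hρ, hW, hP, -one_div, inv, inv3]; ring
  have a2 : r * dot (alph 2) y = ρ * W - ρ * Q := by
    simp [dot, alph, Fin.sum_univ_four, hρ, hW, hQ, -one_div, inv, inv3]; ring
  have a3 : r * dot (alph 3) y = ρ * W + ρ * Q := by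
    simp [dot, alph, Fin.sum_univ_four, hρ, hW, hQ, -one_div, inv, inv3]; ring
  rw [← hP, ← hQ, ← hW]
  simp only [Lam, psi, Fin.sum_univ_four, t, a0, a1, a2, a3, Real.sin_add_pi_div_two]
  simp only [NN, Real.cos_neg, Real.sin_neg, Real.sign_neg, Real.cos_add, Real.cos_sub, Real.sin_add,
    Real.sin_sub, ← sgn_mul]
  ring

lemma int_eq (τ : ℝ) (y : Fin 4 → ℝ) :
    (∫ r : ℝ, Real.exp (-τ * r ^ 2) * Lam r y / r ^ 2) = Real.sqrt 2 *
      JJ (τ / 2) (y 1 - y 0) (y 3 - y 2) ((y 2 + y 3 - y 0 - y 1) / 2) := by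
  have h2 : Real.sqrt 2 * Real.sqrt 2 = 2 := Real.mul_self_sqrt (by norm_num)
  have hs : 0 < Real.sqrt 2 := by positivity
  have := Measure.integral_comp_mul_left (fun a => Real.exp (-(τ / 2) * a ^ 2) *
    (NN (y 1 - y 0) (y 3 - y 2) ((y 2 + y 3 - y 0 - y 1) / 2) a / a ^ 2)) (Real.sqrt 2)
  rw [abs_of_pos (inv_pos.2 hs), smul_eq_mul, inv_mul_eq_div, eq_div_iff hs.ne'] at this
  rw [JJ, GI, ← this, mul_comm, mul_assoc, h2, mul_comm, ← integral_const_mul]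
  congr 1; funext r
  rw [Lam_eq, mul_pow, pow_two (Real.sqrt 2), h2, mul_div_assoc]
  have : -(τ / 2) * (2 * r ^ 2) = -τ * r ^ 2 := by ring
  rw [this]
  generalize NN _ _ _ _ = X
  rw [mul_comm 2 (r ^ 2), div_mul_eq_div_div]; ring

lemma u_eq0 (T t : ℝ) (x : Fin 4 → ℝ) : u T t x =
    -(1 / 16) * JJ ((T - t) / 2) (sortv x 1 - sortv x 0) (sortv x 3 - sortv x 2)
      ((sortv x 2 + sortv x 3 - sortv x 0 - sortv x 1) / 2)
      + (1 / 4) * ∑ i, x i + (1 / 2) * Real.sqrt ((T - t) * Real.pi / 2) := by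
  rw [u, int_eq]
  have hs : Real.sqrt 2 ≠ 0 := by positivity
  field_simp

lemma sort_eq (x : Fin 4 → ℝ) (σ : Equiv.Perm (Fin 4)) (h1 : x (σ 0) ≤ x (σ 1))
    (h2 : x (σ 1) ≤ x (σ 2)) (h3 : x (σ 2) ≤ x (σ 3)) : sortv x = x ∘ σ := by
  have hm : Monotone (x ∘ σ) := by
    rw [Fin.monotone_iff_le_succ]
    intro i
    fin_cases i
    · exact h1
    · exact h2
    · exact h3
  exact (Tuple.comp_sort_eq_comp_iff_monotone.2 hm).symm

lemma u_eq (T t : ℝ) (x : Fin 4 → ℝ) (σ : Equiv.Perm (Fin 4)) (h02 : x (σ 0) ≤ x (σ 2))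
    (h03 : x (σ 0) ≤ x (σ 3)) (h12 : x (σ 1) ≤ x (σ 2)) (h13 : x (σ 1) ≤ x (σ 3)) : u T t x =
    -(1 / 16) * JJ ((T - t) / 2) (x (σ 1) - x (σ 0)) (x (σ 3) - x (σ 2))
      ((x (σ 2) + x (σ 3) - x (σ 0) - x (σ 1)) / 2)
      + (1 / 4) * (x (σ 0) + x (σ 1) + x (σ 2) + x (σ 3))
      + (1 / 2) * Real.sqrt ((T - t) * Real.pi / 2) := by
  have hsum : ∑ i, x i = x (σ 0) + x (σ 1) + x (σ 2) + x (σ 3) := by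
    rw [← Equiv.sum_comp σ x, Fin.sum_univ_four]
  rw [u_eq0, hsum]
  congr 3
  have s01 : ∀ k : Fin 4, (σ * Equiv.swap 0 1 : Equiv.Perm (Fin 4)) k = σ (Equiv.swap 0 1 k) := fun _ => rfl
  have s23 : ∀ k : Fin 4, (σ * Equiv.swap 2 3 : Equiv.Perm (Fin 4)) k = σ (Equiv.swap 2 3 k) := fun _ => rfl
  have s : ∀ k : Fin 4, (σ * Equiv.swap 0 1 * Equiv.swap 2 3 : Equiv.Perm (Fin 4)) k
    = σ (Equiv.swap 0 1 (Equiv.swap 2 3 k)) := fun _ => rfl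
  have e0 : (Equiv.swap 0 1 : Equiv.Perm (Fin 4)) 0 = 1 := by decide
  have e1 : (Equiv.swap 0 1 : Equiv.Perm (Fin 4)) 1 = 0 := by decide
  have e2 : (Equiv.swap 0 1 : Equiv.Perm (Fin 4)) 2 = 2 := by decide
  have e3 : (Equiv.swap 0 1 : Equiv.Perm (Fin 4)) 3 = 3 := by decide
  have f0 : (Equiv.swap 2 3 : Equiv.Perm (Fin 4)) 0 = 0 := by decide
  have f1 : (Equiv.swap 2 3 : Equiv.Perm (Fin 4)) 1 = 1 := by decide
  have f2 : (Equiv.swap 2 3 : Equiv.Perm (Fin 4)) 2 = 3 := by decide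
  have f3 : (Equiv.swap 2 3 : Equiv.Perm (Fin 4)) 3 = 2 := by decide
  rcases le_total (x (σ 0)) (x (σ 1)) with a | a <;> rcases le_total (x (σ 2)) (x (σ 3)) with b | b
  · rw [sort_eq x σ a h12 b]; rfl
  · rw [sort_eq x (σ * Equiv.swap 2 3) (by simpa [s23, f0, f1]) (by simpa [s23, f2, f1])
      (by simpa [s23, f2, f3])]
    simp only [Function.comp, s23, f0, f1, f2, f3]
    rw [← JJ_even_q]; congr 1 <;> ring
  · rw [sort_eq x (σ * Equiv.swap 0 1) (by simpa [s01, e0, e1]) (by simpa [s01, e1, e2])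
      (by simpa [s01, e2, e3])]
    simp only [Function.comp, s01, e0, e1, e2, e3]
    rw [← JJ_even_p]; congr 1 <;> ring
  · rw [sort_eq x (σ * Equiv.swap 0 1 * Equiv.swap 2 3) (by simpa [s, e0, e1, f0, f1])
      (by simpa [s, e1, f1, f2, e3]) (by simpa [s, e2, e3, f2, f3])]
    simp only [Function.comp, s, e0, e1, e2, e3, f0, f1, f2, f3]
    rw [← JJ_even_p, ← JJ_even_q]; congr 1 <;> ring

def GA (κ z0 z1 z2 s : ℝ) : ℝ :=
  -(1 / 16) * (Jp κ (s - z0) ((z1 + z2 - z0 - s) / 2)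
    - 1 / 2 * Jw κ (s - z0) (z2 - z1) ((z1 + z2 - z0 - s) / 2)) + 1 / 4

def GB (κ z0 z1 z2 s : ℝ) : ℝ :=
  -(1 / 16) * (Jq κ (s - z2) ((s + z2 - z0 - z1) / 2)
    + 1 / 2 * Jw κ (z1 - z0) (s - z2) ((s + z2 - z0 - z1) / 2)) + 1 / 4

lemma GA_eq_GB {κ : ℝ} (hκ : 0 < κ) (z0 z1 z2 : ℝ) : GA κ z0 z1 z2 z1 = GB κ z0 z1 z2 z1 := by
  have h := neumann hκ (z1 - z0) (z2 - z1) ((z1 + z2 - z0 - z1) / 2) (by ring)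
  have e1 : z1 - z2 = -(z2 - z1) := by ring
  rw [GA, GB, e1, Jw_even_q, Jq_odd, h]; ring

lemma goodA (z0 z1 z2 s : ℝ) (h01 : z0 ≤ z1) (h12 : z1 ≤ z2) (h : s ≤ z1) :
    Good (s - z0) (z2 - z1) ((z1 + z2 - z0 - s) / 2) := by
  by_cases hw : 0 < (z1 + z2 - z0 - s) / 2
  · exact Or.inl hw
  · right; refine ⟨?_, ?_, ?_⟩ <;> linarith

lemma goodB (z0 z1 z2 s : ℝ) (h01 : z0 ≤ z1) (h12 : z1 ≤ z2) (h : z1 ≤ s) :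
    Good (z1 - z0) (s - z2) ((s + z2 - z0 - z1) / 2) := by
  by_cases hw : 0 < (s + z2 - z0 - z1) / 2
  · exact Or.inl hw
  · right; refine ⟨?_, ?_, ?_⟩ <;> linarith

lemma uline {T t : ℝ} (htT : t < T) (y : Fin 4 → ℝ) (σ : Equiv.Perm (Fin 4))
    (h01 : y (σ 0) ≤ y (σ 2)) (h12 : y (σ 2) ≤ y (σ 3)) (D : ℝ)
    (hA : y (σ 1) ≤ y (σ 2) → D = GA ((T - t) / 2) (y (σ 0)) (y (σ 2)) (y (σ 3)) (y (σ 1)))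
    (hB : y (σ 2) ≤ y (σ 1) → D = GB ((T - t) / 2) (y (σ 0)) (y (σ 2)) (y (σ 3)) (y (σ 1))) :
    HasDerivAt (fun s => u T t (Function.update y (σ 1) s)) D (y (σ 1)) := by
  have hκ : 0 < (T - t) / 2 := by linarith
  set κ := (T - t) / 2 with hκd
  have u0 : ∀ s, Function.update y (σ 1) s (σ 0) = y (σ 0) := fun s =>
    Function.update_of_ne (by simp) _ _
  have u1 : ∀ s, Function.update y (σ 1) s (σ 1) = s := fun s => Function.update_self _ _ _
  have u2 : ∀ s, Function.update y (σ 1) s (σ 2) = y (σ 2) := fun s =>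
    Function.update_of_ne (by simp) _ _
  have u3 : ∀ s, Function.update y (σ 1) s (σ 3) = y (σ 3) := fun s =>
    Function.update_of_ne (by simp) _ _
  obtain ⟨z0, e0⟩ : ∃ z, z = y (σ 0) := ⟨_, rfl⟩
  obtain ⟨z1, e1⟩ : ∃ z, z = y (σ 2) := ⟨_, rfl⟩
  obtain ⟨z2, e2⟩ : ∃ z, z = y (σ 3) := ⟨_, rfl⟩
  obtain ⟨s0, e3⟩ : ∃ z, z = y (σ 1) := ⟨_, rfl⟩
  rw [← e0, ← e1, ← e2, ← e3] at hA hB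
  rw [← e0] at u0 h01
  rw [← e1] at u2 h01 h12
  rw [← e2] at u3 h12
  rw [← e3]
  set C := (1 / 2) * Real.sqrt ((T - t) * Real.pi / 2) with hC
  refine glue _
    (fun s => -(1 / 16) * JJ κ (s - z0) (z2 - z1) ((z1 + z2 - z0 - s) / 2)
      + (1 / 4) * (z0 + s + z1 + z2) + C)
    (fun s => -(1 / 16) * JJ κ (z1 - z0) (s - z2) ((s + z2 - z0 - z1) / 2)
      + (1 / 4) * (z0 + s + z1 + z2) + C) z1 s0 D ?_ ?_ ?_ ?_
  · intro s hs
    have := u_eq T t (Function.update y (σ 1) s) σ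
    simp only [u0, u1, u2, u3] at this
    rw [this h01 (h01.trans h12) hs (hs.trans h12)]
  · intro s hs
    have := u_eq T t (Function.update y (σ 1) s) (σ * Equiv.swap 1 2)
    have ss : ∀ k : Fin 4, (σ * Equiv.swap 1 2 : Equiv.Perm (Fin 4)) k = σ (Equiv.swap 1 2 k) := fun _ => rfl
    have f0 : (Equiv.swap 1 2 : Equiv.Perm (Fin 4)) 0 = 0 := by decide
    have f1 : (Equiv.swap 1 2 : Equiv.Perm (Fin 4)) 1 = 2 := by decide
    have f2 : (Equiv.swap 1 2 : Equiv.Perm (Fin 4)) 2 = 1 := by decide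
    have f3 : (Equiv.swap 1 2 : Equiv.Perm (Fin 4)) 3 = 3 := by decide
    simp only [ss, f0, f1, f2, f3, u0, u1, u2, u3] at this
    rw [this (h01.trans hs) (h01.trans h12) hs h12]
    have e : z2 - s = -(s - z2) := by ring
    rw [e, JJ_even_q, ← hκd]
    ring
  · intro h
    have d := J_deriv hκ (fun s => s - z0) (fun _ => z2 - z1) (fun s => (z1 + z2 - z0 - s) / 2)
      1 0 (-1 / 2) s0 ((hasDerivAt_id s0).sub_const z0) (hasDerivAt_const _ _)
      (((hasDerivAt_id s0).const_sub _).div_const 2) (goodA z0 z1 z2 s0 h01 h12 h)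
    have d2 : HasDerivAt (fun s : ℝ => (1 / 4) * (z0 + s + z1 + z2)) (1 / 4 * 1) s0 :=
      ((((hasDerivAt_id s0).const_add z0).add_const z1).add_const z2).const_mul _
    refine (((d.const_mul _).add d2).add_const C).congr_deriv ?_
    rw [hA h, GA]; ring
  · intro h
    have d := J_deriv hκ (fun _ => z1 - z0) (fun s => s - z2) (fun s => (s + z2 - z0 - z1) / 2)
      0 1 (1 / 2) s0 (hasDerivAt_const _ _) ((hasDerivAt_id s0).sub_const z2)
      (((((hasDerivAt_id s0).add_const _).sub_const _).sub_const _).div_const 2)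
      (goodB z0 z1 z2 s0 h01 h12 h)
    have d2 : HasDerivAt (fun s : ℝ => (1 / 4) * (z0 + s + z1 + z2)) (1 / 4 * 1) s0 :=
      ((((hasDerivAt_id s0).const_add z0).add_const z1).add_const z2).const_mul _
    refine (((d.const_mul _).add d2).add_const C).congr_deriv ?_
    rw [hB h, GB]; ring

lemma pdA {T t : ℝ} (htT : t < T) (y : Fin 4 → ℝ) (σ : Equiv.Perm (Fin 4))
    (h01 : y (σ 0) ≤ y (σ 2)) (h12 : y (σ 2) ≤ y (σ 3)) (h : y (σ 1) ≤ y (σ 2)) :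
    pd (σ 1) (u T t) y = GA ((T - t) / 2) (y (σ 0)) (y (σ 2)) (y (σ 3)) (y (σ 1)) :=
  (uline htT y σ h01 h12 _ (fun _ => rfl) (fun h' => by
    rw [le_antisymm h h']; exact GA_eq_GB (by linarith) _ _ _)).deriv

lemma pdB {T t : ℝ} (htT : t < T) (y : Fin 4 → ℝ) (σ : Equiv.Perm (Fin 4))
    (h01 : y (σ 0) ≤ y (σ 2)) (h12 : y (σ 2) ≤ y (σ 3)) (h : y (σ 2) ≤ y (σ 1)) :
    pd (σ 1) (u T t) y = GB ((T - t) / 2) (y (σ 0)) (y (σ 2)) (y (σ 3)) (y (σ 1)) :=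
  (uline htT y σ h01 h12 _ (fun h' => by
    rw [le_antisymm h' h]; exact (GA_eq_GB (by linarith) _ _ _).symm) (fun _ => rfl)).deriv


lemma perm_of (a i b c : Fin 4) (h : Function.Bijective ![a, i, b, c]) :
    ∃ σ : Equiv.Perm (Fin 4), σ 0 = a ∧ σ 1 = i ∧ σ 2 = b ∧ σ 3 = c :=
  ⟨Equiv.ofBijective _ h, rfl, rfl, rfl, rfl⟩

lemma pdAu {T t : ℝ} (htT : t < T) (y : Fin 4 → ℝ) (a i b c : Fin 4)
    (hb : Function.Bijective ![a, i, b, c])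
    (h01 : y a ≤ y b) (h12 : y b ≤ y c) (h : y i ≤ y b) :
    pd i (u T t) y = GA ((T - t) / 2) (y a) (y b) (y c) (y i) := by
  obtain ⟨σ, rfl, rfl, rfl, rfl⟩ := perm_of a i b c hb
  exact pdA htT y σ h01 h12 h

lemma pdBu {T t : ℝ} (htT : t < T) (y : Fin 4 → ℝ) (a i b c : Fin 4)
    (hb : Function.Bijective ![a, i, b, c])
    (h01 : y a ≤ y b) (h12 : y b ≤ y c) (h : y b ≤ y i) :
    pd i (u T t) y = GB ((T - t) / 2) (y a) (y b) (y c) (y i) := by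
  obtain ⟨σ, rfl, rfl, rfl, rfl⟩ := perm_of a i b c hb
  exact pdB htT y σ h01 h12 h

lemma sqrt_fact {τ : ℝ} (hτ : 0 < τ) :
    Real.sqrt (Real.pi / (τ / 2)) = Real.pi / Real.sqrt (τ * Real.pi / 2) := by
  have hπ := Real.pi_pos
  rw [Real.sqrt_eq_iff_mul_self_eq_of_pos (by positivity)]
  have : Real.sqrt (τ * Real.pi / 2) ^ 2 = τ * Real.pi / 2 := Real.sq_sqrt (by positivity)
  rw [div_mul_div_comm, ← pow_two (Real.sqrt _), this]
  field_simp

theorem main_aux (T t : ℝ) (htT : t < T) (x : Fin 4 → ℝ)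
    (h01 : x 0 ≤ x 1) (h12 : x 1 ≤ x 2) (h23 : x 2 ≤ x 3) :
    ∃ dt p22 p24 p44 : ℝ,
      HasDerivAt (fun s => u T s x) dt t ∧
      HasDerivAt (fun s => pd 1 (u T t) (Function.update x 1 s)) p22 (x 1) ∧
      HasDerivAt (fun s => pd 1 (u T t) (Function.update x 3 s)) p24 (x 3) ∧
      HasDerivAt (fun s => pd 3 (u T t) (Function.update x 3 s)) p44 (x 3) ∧
      dt + (1 / 2) * (p22 + 2 * p24 + p44) = 0 := by
  have hκ : 0 < (T - t) / 2 := by linarith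
  obtain ⟨κ, hκd⟩ : ∃ k, k = (T - t) / 2 := ⟨_, rfl⟩
  obtain ⟨P, hP⟩ : ∃ k, k = x 1 - x 0 := ⟨_, rfl⟩
  obtain ⟨Q, hQ⟩ : ∃ k, k = x 3 - x 2 := ⟨_, rfl⟩
  obtain ⟨W, hW⟩ : ∃ k, k = (x 2 + x 3 - x 0 - x 1) / 2 := ⟨_, rfl⟩
  rw [← hκd] at hκ
  have hg : Good P Q W := by
    by_cases hw : 0 < W
    · exact Or.inl hw
    · right; refine ⟨?_, ?_, ?_⟩ <;> linarith
  obtain ⟨D, hD⟩ := Jw_deriv hκ P Q W hg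
  -- x 0 = x0 etc.
  have up1 : ∀ s (j : Fin 4), j ≠ 1 → Function.update x 1 s j = x j := fun s j h =>
    Function.update_of_ne h _ _
  have up3 : ∀ s (j : Fin 4), j ≠ 3 → Function.update x 3 s j = x j := fun s j h =>
    Function.update_of_ne h _ _
  have a0 := fun s => up1 s 0 (by decide)
  have a2 := fun s => up1 s 2 (by decide)
  have a3 := fun s => up1 s 3 (by decide)
  have a1 : ∀ s, Function.update x 1 s 1 = s := fun s => Function.update_self _ _ _
  have b0 := fun s => up3 s 0 (by decide)
  have b1 := fun s => up3 s 1 (by decide)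
  have b2 := fun s => up3 s 2 (by decide)
  have b3 : ∀ s, Function.update x 3 s 3 = s := fun s => Function.update_self _ _ _
  -- generic derivative of Jp part and Jq part
  have dP : ∀ (p w : ℝ → ℝ) (p1 w1 s0 : ℝ), HasDerivAt p p1 s0 → HasDerivAt w w1 s0 →
      p s0 = P → w s0 = W →
      HasDerivAt (fun s => Jp κ (p s) (w s)) (p1 * Jpp κ P W + w1 * Jpw κ P W) s0 := by
    intro p w p1 w1 s0 h1 h2 h3 h4
    have := Jp_deriv hκ p w p1 w1 s0 Q h1 h2 (by rw [h3, h4]; exact hg)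
    rwa [h3, h4] at this
  have dQ : ∀ (q w : ℝ → ℝ) (q1 w1 s0 : ℝ), HasDerivAt q q1 s0 → HasDerivAt w w1 s0 →
      q s0 = Q → w s0 = W →
      HasDerivAt (fun s => Jq κ (q s) (w s)) (q1 * Jqq κ Q W + w1 * Jqw κ Q W) s0 := by
    intro q w q1 w1 s0 h1 h2 h3 h4
    have := Jq_deriv hκ q w q1 w1 s0 P h1 h2 (by rw [h3, h4]; exact hg)
    rwa [h3, h4] at this
  -- generic affine derivs
  have lin : ∀ (c s0 : ℝ), HasDerivAt (fun s : ℝ => s - c) 1 s0 := fun c s0 =>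
    (hasDerivAt_id s0).sub_const c
  have linm : ∀ (c s0 : ℝ), HasDerivAt (fun s : ℝ => c - s) (-1) s0 := fun c s0 =>
    (hasDerivAt_id s0).const_sub c
  have hwA : ∀ (c s0 : ℝ), HasDerivAt (fun s : ℝ => (c - s) / 2) (-1 / 2) s0 := fun c s0 =>
    (linm c s0).div_const 2
  have hwB : ∀ (c d e s0 : ℝ), HasDerivAt (fun s : ℝ => (s + c - d - e) / 2) (1 / 2) s0 :=
    fun c d e s0 => (((((hasDerivAt_id s0).add_const _).sub_const _).sub_const _).div_const 2)
  have hwC : ∀ (c d e s0 : ℝ), HasDerivAt (fun s : ℝ => (c + s - d - e) / 2) (1 / 2) s0 :=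
    fun c d e s0 => (((((hasDerivAt_id s0).const_add _).sub_const _).sub_const _).div_const 2)
  refine ⟨-(1 / 32) * GI κ (NN P Q W)
      - Real.pi / (8 * Real.sqrt ((T - t) * Real.pi / 2)),
    -(1 / 16) * (Jpp κ P W - Jpw κ P W + D / 4),
    -(1 / 16) * (1 / 2 * Jpw κ P W - 1 / 2 * (Jqw κ Q W + D / 2)),
    -(1 / 16) * (Jqq κ Q W + Jqw κ Q W + D / 4), ?_, ?_, ?_, ?_, ?_⟩
  · have e : (fun s => u T s x) = fun s => -(1 / 16) * JJ ((T - s) / 2) P Q W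
        + (1 / 4) * (x 0 + x 1 + x 2 + x 3)
        + (1 / 2) * Real.sqrt ((T - s) * Real.pi / 2) := by
      funext s
      have := u_eq T s x 1 (h01.trans h12) ((h01.trans h12).trans h23) h12 (h12.trans h23)
      simp only [Equiv.Perm.coe_one, id_eq] at this
      rw [this, hP, hQ, hW]
    rw [e]
    have hJ := Jt_deriv hκ P Q W
    have hpos : 0 < (T - t) * Real.pi / 2 := by
      have := Real.pi_pos
      have : 0 < T - t := by linarith
      positivity
    rw [hκd] at hJ
    have d1 := HasDerivAt.comp t hJ (hwA T t)
    have d2 : HasDerivAt (fun s => Real.sqrt ((T - s) * Real.pi / 2))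
        (-1 * Real.pi / 2 / (2 * Real.sqrt ((T - t) * Real.pi / 2))) t :=
      (((linm T t).mul_const Real.pi).div_const 2).sqrt hpos.ne'
    refine (((d1.const_mul (-(1 / 16))).add_const _).add (d2.const_mul (1 / 2))).congr_deriv ?_
    rw [← hκd]
    have := (Real.sqrt_pos.2 hpos).ne'
    field_simp
    ring
  · refine glue _ (fun s => GA κ (x 0) (x 2) (x 3) s) (fun s => GB κ (x 0) (x 2) (x 3) s)
      (x 2) (x 1) _ ?_ ?_ ?_ ?_
    · intro s hs
      have := pdAu htT (Function.update x 1 s) 0 1 2 3 (by decide)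
      simp only [a0, a1, a2, a3, ← hκd] at this
      exact this (h01.trans h12) h23 hs
    · intro s hs
      have := pdBu htT (Function.update x 1 s) 0 1 2 3 (by decide)
      simp only [a0, a1, a2, a3, ← hκd] at this
      exact this (h01.trans h12) h23 hs
    · intro h
      have d1 := dP (fun s => s - x 0) (fun s => (x 2 + x 3 - x 0 - s) / 2) _ _ (x 1)
        (lin _ _) (hwA _ _) hP.symm hW.symm
      have d2 := hD (fun s => s - x 0) (fun _ => x 3 - x 2) (fun s => (x 2 + x 3 - x 0 - s) / 2)
        _ _ _ (x 1) (lin _ _) (hasDerivAt_const _ _) (hwA _ _) hP.symm hQ.symm hW.symm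
      unfold GA
      refine (((d1.sub (d2.const_mul (1 / 2))).const_mul (-(1 / 16))).add_const
        (1 / 4)).congr_deriv ?_
      ring
    · intro h
      have h' : x 1 = x 2 := le_antisymm h12 h
      have d1 := dQ (fun s => x 3 - s) (fun s => (s + x 3 - x 0 - x 2) / 2) _ _ (x 1)
        (linm _ _) (hwB _ _ _ _) (by rw [hQ, h']) (by rw [hW, h'])
      have d2 := hD (fun _ => x 2 - x 0) (fun s => x 3 - s) (fun s => (s + x 3 - x 0 - x 2) / 2)
        _ _ _ (x 1) (hasDerivAt_const _ _) (linm _ _) (hwB _ _ _ _) (by rw [hP, h'])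
        (by rw [hQ, h']) (by rw [hW, h'])
      have e : (fun s => GB κ (x 0) (x 2) (x 3) s) = fun s =>
          -(1 / 16) * (-Jq κ (x 3 - s) ((s + x 3 - x 0 - x 2) / 2)
    + 1 / 2 * Jw κ (x 2 - x 0) (x 3 - s) ((s + x 3 - x 0 - x 2) / 2)) + 1 / 4 := by
        funext s
        have e1 : s - x 3 = -(x 3 - s) := by ring
        rw [GB, e1, Jq_odd, Jw_even_q]
      rw [e]
      refine (((d1.neg.add (d2.const_mul (1 / 2))).const_mul (-(1 / 16))).add_const
        (1 / 4)).congr_deriv ?_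
      have m := matching hκ P Q W (by rw [hP, hQ, hW, h']; ring)
      linarith
  · refine glue _ (fun s => -(1 / 16) * (-Jq κ (x 2 - x 1) ((x 1 + x 2 - x 0 - s) / 2)
        + 1 / 2 * Jw κ (s - x 0) (x 2 - x 1) ((x 1 + x 2 - x 0 - s) / 2)) + 1 / 4)
      (fun s => -(1 / 16) * (Jp κ (x 1 - x 0) ((x 2 + s - x 0 - x 1) / 2)
        - 1 / 2 * Jw κ (x 1 - x 0) (s - x 2) ((x 2 + s - x 0 - x 1) / 2)) + 1 / 4)
      (x 1) (x 3) _ ?_ ?_ ?_ ?_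
    · intro s hs
      have e1 : x 1 - x 2 = -(x 2 - x 1) := by ring
      rcases le_total (x 0) s with h | h
      · have := pdBu htT (Function.update x 3 s) 0 1 3 2 (by decide)
        simp only [b0, b1, b2, b3, ← hκd] at this
        rw [this h (hs.trans h12) hs, GB, e1, Jq_odd, Jw_even_q]
      · have := pdBu htT (Function.update x 3 s) 3 1 0 2 (by decide)
        simp only [b0, b1, b2, b3, ← hκd] at this
        have e2 : x 0 - s = -(s - x 0) := by ring
        have e3 : x 1 + x 2 - s - x 0 = x 1 + x 2 - x 0 - s := by ring
        rw [this h (h01.trans h12) h01, GB, e1, Jq_odd, Jw_even_q, e2, Jw_even_p, e3]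
    · intro s hs
      rcases le_total (x 2) s with h | h
      · have := pdAu htT (Function.update x 3 s) 0 1 2 3 (by decide)
        simp only [b0, b1, b2, b3, ← hκd] at this
        rw [this (h01.trans h12) h h12, GA]
      · have := pdAu htT (Function.update x 3 s) 0 1 3 2 (by decide)
        simp only [b0, b1, b2, b3, ← hκd] at this
        have e2 : x 2 - s = -(s - x 2) := by ring
        rw [this (h01.trans hs) h hs, GA, e2, Jw_even_q, add_comm s (x 2)]
    · intro h
      have h1 : x 2 = x 1 := by linarith
      have h3 : x 3 = x 1 := by linarith
      have d1 := dQ (fun _ => x 2 - x 1) (fun s => (x 1 + x 2 - x 0 - s) / 2) _ _ (x 3)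
        (hasDerivAt_const _ _) (hwA _ _) (by rw [hQ, h1, h3]) (by rw [hW, h1, h3])
      have d2 := hD (fun s => s - x 0) (fun _ => x 2 - x 1) (fun s => (x 1 + x 2 - x 0 - s) / 2)
        _ _ _ (x 3) (lin _ _) (hasDerivAt_const _ _) (hwA _ _) (by rw [hP, h3])
        (by rw [hQ, h1, h3]) (by rw [hW, h1, h3])
      refine (((d1.neg.add (d2.const_mul (1 / 2))).const_mul (-(1 / 16))).add_const
        (1 / 4)).congr_deriv ?_
      have q0 : Q = 0 := by rw [hQ, h1, h3]; ring
      have m0 : Jqw κ Q W = 0 := by rw [q0]; exact Jqw_zero _ _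
      rw [m0]
      ring
    · intro h
      have d1 := dP (fun _ => x 1 - x 0) (fun s => (x 2 + s - x 0 - x 1) / 2) _ _ (x 3)
        (hasDerivAt_const _ _) (hwC _ _ _ _) hP.symm hW.symm
      have d2 := hD (fun _ => x 1 - x 0) (fun s => s - x 2) (fun s => (x 2 + s - x 0 - x 1) / 2)
        _ _ _ (x 3) (hasDerivAt_const _ _) (lin _ _) (hwC _ _ _ _) hP.symm hQ.symm hW.symm
      refine (((d1.sub (d2.const_mul (1 / 2))).const_mul (-(1 / 16))).add_const
        (1 / 4)).congr_deriv ?_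
      ring
  · refine glue _ (fun s => GA κ (x 0) (x 1) (x 2) s) (fun s => GB κ (x 0) (x 1) (x 2) s)
      (x 1) (x 3) _ ?_ ?_ ?_ ?_
    · intro s hs
      have := pdAu htT (Function.update x 3 s) 0 3 1 2 (by decide)
      simp only [b0, b1, b2, b3, ← hκd] at this
      exact this h01 h12 hs
    · intro s hs
      have := pdBu htT (Function.update x 3 s) 0 3 1 2 (by decide)
      simp only [b0, b1, b2, b3, ← hκd] at this
      exact this h01 h12 hs
    · intro h
      have h1 : x 2 = x 1 := by linarith
      have h3 : x 3 = x 1 := by linarith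
      have d1 := dP (fun s => s - x 0) (fun s => (x 1 + x 2 - x 0 - s) / 2) _ _ (x 3)
        (lin _ _) (hwA _ _) (by rw [hP, h3]) (by rw [hW, h1, h3])
      have d2 := hD (fun s => s - x 0) (fun _ => x 2 - x 1) (fun s => (x 1 + x 2 - x 0 - s) / 2)
        _ _ _ (x 3) (lin _ _) (hasDerivAt_const _ _) (hwA _ _) (by rw [hP, h3])
        (by rw [hQ, h1, h3]) (by rw [hW, h1, h3])
      unfold GA
      refine (((d1.sub (d2.const_mul (1 / 2))).const_mul (-(1 / 16))).add_const
        (1 / 4)).congr_deriv ?_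
      have m := matching hκ P Q W (by rw [hP, hQ, hW, h1, h3]; ring)
      have q0 : Q = 0 := by rw [hQ, h1, h3]; ring
      have m0 : Jqw κ Q W = 0 := by rw [q0]; exact Jqw_zero _ _
      linarith
    · intro h
      have d1 := dQ (fun s => s - x 2) (fun s => (s + x 2 - x 0 - x 1) / 2) _ _ (x 3)
        (lin _ _) (hwB _ _ _ _) hQ.symm (by rw [hW]; ring)
      have d2 := hD (fun _ => x 1 - x 0) (fun s => s - x 2) (fun s => (s + x 2 - x 0 - x 1) / 2)
        _ _ _ (x 3) (hasDerivAt_const _ _) (lin _ _) (hwB _ _ _ _) hP.symm hQ.symm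
        (by rw [hW]; ring)
      unfold GB
      refine (((d1.add (d2.const_mul (1 / 2))).const_mul (-(1 / 16))).add_const
        (1 / 4)).congr_deriv ?_
      ring
  · rw [NN_int hκ, hκd, sqrt_fact (by linarith)]
    ring


/-- u^T solves the comb-strategy linear PDE
∂_t u + (1/2)(e₂+e₄)ᵀ ∂²_{xx} u (e₂+e₄) = 0 at sorted points. -/
theorem u_comb_pde (T t : ℝ) (ht : 0 ≤ t) (htT : t < T) (x : Fin 4 → ℝ)
    (h01 : x 0 ≤ x 1) (h12 : x 1 ≤ x 2) (h23 : x 2 ≤ x 3) :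
    ∃ dt p22 p24 p44 : ℝ,
      HasDerivAt (fun s => u T s x) dt t ∧
      HasDerivAt (fun s => pd 1 (u T t) (Function.update x 1 s)) p22 (x 1) ∧
      HasDerivAt (fun s => pd 1 (u T t) (Function.update x 3 s)) p24 (x 3) ∧
      HasDerivAt (fun s => pd 3 (u T t) (Function.update x 3 s)) p44 (x 3) ∧
      dt + (1 / 2) * (p22 + 2 * p24 + p44) = 0 := by
  exact main_aux T t htT x h01 h12 h23

end
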